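/- arXiv:1912.05113 — 12 statements merged into one kernel-verified Lean document; each statement's English description precedes it below -/
import Mathlib

section
/- For every integer N = 2M with M ≥ 1, every φ ∈ (0,1), and every k with 1 ≤ k ≤ M−1, the vectors z_k^+ = (cos(θ k i))_{i=0}^{N−1} and z_k^- = (sin(θ k i))_{i=0}^{N−1} (with θ = 2π/N) are nonzero and satisfy D̄(φ) z_k^+ = χ_k(φ) z_k^+ and D̄(φ) z_k^- = χ_k(φ) z_k^-; that is, they are eigenvectors of the row-normalized racetrack proximity matrix with eigenvalue χ_k(φ). -/
open Real Matrix Finset Set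

noncomputable section

/-- Racetrack distance between regions `i` and `j` on the circle with `N` regions. -/
def rdist (N : ℕ) (i j : Fin N) : ℕ :=
  min (max ((i : ℕ) - (j : ℕ)) ((j : ℕ) - (i : ℕ)))
      (N - max ((i : ℕ) - (j : ℕ)) ((j : ℕ) - (i : ℕ)))

/-- Racetrack proximity matrix `D(φ)` with entries `φ ^ ℓ_{ij}`. -/
def Dmat (N : ℕ) (φ : ℝ) : Matrix (Fin N) (Fin N) ℝ :=
  Matrix.of fun i j => φ ^ rdist N i j

/-- Common row sum `S(φ) = (1+φ)(1-φ^M)/(1-φ)`. -/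
def Srow (M : ℕ) (φ : ℝ) : ℝ := (1 + φ) * (1 - φ ^ M) / (1 - φ)

/-- Row-normalized proximity matrix `D̄(φ) = S(φ)⁻¹ D(φ)`. -/
def Dbar (N M : ℕ) (φ : ℝ) : Matrix (Fin N) (Fin N) ℝ := (Srow M φ)⁻¹ • Dmat N φ

/-- `Ψ_k(φ) = (1-φ²)/(1 - 2 φ cos(θ k) + φ²)` with `θ = 2π/N`. -/
def Psi (N k : ℕ) (φ : ℝ) : ℝ :=
  (1 - φ ^ 2) / (1 - 2 * φ * Real.cos (2 * Real.pi / N * k) + φ ^ 2)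

/-- `Ψ̄(φ) = (1+φ^M)/(1-φ^M)`. -/
def PsiBar (M : ℕ) (φ : ℝ) : ℝ := (1 + φ ^ M) / (1 - φ ^ M)

/-- Eigenvalues `χ_k(φ)` of the row-normalized racetrack proximity matrix. -/
def chi (N M k : ℕ) (φ : ℝ) : ℝ :=
  if Even k then Psi N k φ * Psi N M φ
  else Psi N k φ * Psi N M φ * PsiBar M φ

lemma rt_tele (f : ℕ → ℝ) (g φ c : ℝ) (h0 : f 1 + g = 2 * c * f 0)
    (h : ∀ n, f (n + 2) + f n = 2 * c * f (n + 1)) (n : ℕ) :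
    (1 - 2 * φ * c + φ ^ 2) * ∑ m ∈ Finset.range (n + 1), φ ^ m * f m
      = f 0 - φ * g - φ ^ (n + 1) * f (n + 1) + φ ^ (n + 2) * f n := by
  induction n with
  | zero =>
    simp only [zero_add, Finset.sum_range_one, pow_zero, one_mul, pow_one]
    linear_combination φ * h0
  | succ n ih =>
    rw [Finset.sum_range_succ, mul_add, ih]
    have := h n
    rw [show n + 1 + 1 = n + 2 from rfl]
    linear_combination φ ^ (n + 2) * this

lemma rt_main (M : ℕ) (hM : 1 ≤ M) (φ c ε : ℝ) (f : ℤ → ℝ)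
    (hε : ε * ε = 1)
    (hc : ∀ n, f (n + 1) + f (n - 1) = 2 * c * f n) (hp : ∀ n, f (n + M) = ε * f n)
    (i : Fin (2 * M)) :
    (1 - 2 * φ * c + φ ^ 2) * ∑ j : Fin (2 * M), φ ^ rdist (2 * M) i j * f ((j : ℕ) : ℤ)
      = (1 - φ ^ 2) * (1 - ε * φ ^ M) * f ((i : ℕ) : ℤ) := by
  have : NeZero (2 * M) := ⟨by omega⟩
  have hp2 : ∀ n, f (n + 2 * M) = f n := by
    intro n
    rw [show n + 2 * (M : ℤ) = n + M + M by ring, hp, hp, ← mul_assoc, hε, one_mul]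
  have hm : ∀ n, f (n - M) = ε * f n := by
    intro n
    have := hp (n - M)
    rw [sub_add_cancel] at this
    rw [this, ← mul_assoc, hε, one_mul]
  have hsum : ∑ j : Fin (2 * M), φ ^ rdist (2 * M) i j * f ((j : ℕ) : ℤ)
      = ∑ m ∈ Finset.range (2 * M), φ ^ (min m (2 * M - m)) * f ((i : ℕ) + (m : ℤ)) := by
    rw [← Fin.sum_univ_eq_sum_range
      (fun m => φ ^ (min m (2 * M - m)) * f ((i : ℕ) + (m : ℤ))) (2 * M)]
    rw [← Equiv.sum_comp (Equiv.addLeft i)]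
    refine Finset.sum_congr rfl fun m _ => ?_
    simp only [Equiv.coe_addLeft]
    have hi := i.2
    have hm2 := m.2
    have hv := Fin.val_add i m
    by_cases hlt : (i : ℕ) + m < 2 * M
    · rw [Nat.mod_eq_of_lt hlt] at hv
      congr 2
      · unfold rdist
        rw [hv]; omega
      · rw [hv]; push_cast; ring
    · have hv2 : ((i + m : Fin (2 * M)) : ℕ) = (i : ℕ) + m - 2 * M := by
        rw [hv, Nat.mod_eq_sub_mod (by omega), Nat.mod_eq_of_lt (by omega)]
      congr 1
      · congr 1
        unfold rdist
        rw [hv2]; omega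
      · rw [hv2, ← hp2]
        congr 1
        rw [Nat.cast_sub (by omega)]; push_cast; ring
  have hsplit : ∑ m ∈ Finset.range (2 * M), φ ^ (min m (2 * M - m)) * f ((i : ℕ) + (m : ℤ))
      = ∑ m ∈ Finset.range M, φ ^ m * f ((i : ℕ) + (m : ℤ))
        + φ * ∑ m ∈ Finset.range M, φ ^ m * f ((i : ℕ) - 1 - (m : ℤ)) := by
    generalize ((i : ℕ) : ℤ) = y
    rw [two_mul M, Finset.sum_range_add]
    congr 1
    · refine Finset.sum_congr rfl fun m h => ?_
      rw [Finset.mem_range] at h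
      rw [min_eq_left (by omega)]
    · rw [← Finset.sum_range_reflect, Finset.mul_sum]
      refine Finset.sum_congr rfl fun m h => ?_
      rw [Finset.mem_range] at h
      rw [min_eq_right (by omega), show M + M - (M + (M - 1 - m)) = m + 1 by omega, pow_succ']
      rw [mul_assoc, ← hp2 (y - 1 - (m : ℤ))]
      congr 3
      omega
  rw [hsum, hsplit]
  obtain ⟨n, rfl⟩ : ∃ n, M = n + 1 := ⟨M - 1, by omega⟩
  set x : ℤ := ((i : ℕ) : ℤ)
  have e1 := rt_tele (fun m => f (x + (m : ℤ))) (f (x - 1)) φ c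
    (by simpa using hc x)
    (by intro m
        have := hc (x + m + 1)
        push_cast
        rw [← add_assoc, ← add_assoc, ← this]
        congr 2 <;> ring) n
  have e2 := rt_tele (fun m => f (x - 1 - (m : ℤ))) (f x) φ c
    (by have := hc (x - 1)
        simp only [Nat.cast_one, Nat.cast_zero, sub_zero, sub_add_cancel] at *
        linarith)
    (by intro m
        have := hc (x - 1 - m - 1)
        push_cast
        rw [show x - 1 - ((m : ℤ) + 1) = x - 1 - m - 1 by ring, ← this, add_comm]
        congr 2 <;> ring) n
  rw [mul_add, mul_left_comm, e1, e2]
  have a1 := hp x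
  have a2 := hp (x - 1)
  have a3 := hm x
  have a4 := hm (x - 1)
  push_cast at a1 a2 a3 a4 ⊢
  rw [show x - 1 + ((n : ℤ) + 1) = x + n by ring] at a2
  rw [show x - ((n : ℤ) + 1) = x - 1 - n by ring] at a3
  simp only [add_zero, sub_zero]
  rw [a1, a2, a3, a4]
  ring

lemma rt_eig (M : ℕ) (hM : 1 ≤ M) (φ : ℝ) (hφ : φ ∈ Set.Ioo (0 : ℝ) 1) (k : ℕ)
    (f : ℤ → ℝ)
    (hc : ∀ n, f (n + 1) + f (n - 1) = 2 * Real.cos (2 * Real.pi / (2 * M : ℕ) * k) * f n)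
    (hp : ∀ n, f (n + M) = (-1) ^ k * f n) :
    (Dbar (2 * M) M φ).mulVec (fun i => f ((i : ℕ) : ℤ)) =
      chi (2 * M) M k φ • (fun i : Fin (2 * M) => f ((i : ℕ) : ℤ)) := by
  obtain ⟨h0, h1⟩ := hφ
  have hpow : φ ^ M < 1 := pow_lt_one₀ h0.le h1 (by omega)
  funext i
  have key := rt_main M hM φ _ ((-1) ^ k) f (by rw [← mul_pow]; simp) hc hp i
  have hMr : (M : ℝ) ≠ 0 := by positivity
  have hcos : Real.cos (2 * Real.pi / (2 * M : ℕ) * M) = -1 := by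
    rw [← Real.cos_pi]
    congr 1
    push_cast
    field_simp
  have hq : 0 < 1 - 2 * φ * Real.cos (2 * Real.pi / (2 * M : ℕ) * k) + φ ^ 2 := by
    have := Real.cos_le_one (2 * Real.pi / (2 * M : ℕ) * k)
    nlinarith [mul_nonneg h0.le (sub_nonneg.2 this), mul_pos (sub_pos.2 h1) (sub_pos.2 h1)]
  have hlhs : (Dbar (2 * M) M φ).mulVec (fun i => f ((i : ℕ) : ℤ)) i
      = (Srow M φ)⁻¹ * ∑ j : Fin (2 * M), φ ^ rdist (2 * M) i j * f ((j : ℕ) : ℤ) := by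
    simp [Dbar, Dmat, Matrix.mulVec, dotProduct, Finset.mul_sum, mul_assoc]
  rw [hlhs, Pi.smul_apply, smul_eq_mul]
  unfold chi Psi PsiBar Srow
  rw [hcos]
  set q := 1 - 2 * φ * Real.cos (2 * Real.pi / (2 * M : ℕ) * k) + φ ^ 2 with hqd
  rw [mul_comm, ← eq_div_iff hq.ne'] at key
  rw [key]
  have hd1 : 1 - φ ≠ 0 := by linarith
  have hd2 : 1 + φ ≠ 0 := by linarith
  have hd3 : 1 - φ ^ M ≠ 0 := by linarith
  have hd4 : 1 - 2 * φ * (-1) + φ ^ 2 = (1 + φ) ^ 2 := by ring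
  rw [hd4]
  split_ifs with hk
  · rw [hk.neg_one_pow]
    field_simp
    ring
  · rw [(Nat.not_even_iff_odd.1 hk).neg_one_pow]
    field_simp
    ring

/-- For `N = 2M`, `M ≥ 1`, `φ ∈ (0,1)`, and `1 ≤ k ≤ M − 1`, the cosine and sine vectors
`z_k⁺ = (cos(θ k i))_i` and `z_k⁻ = (sin(θ k i))_i` (with `θ = 2π/N`) are nonzero
eigenvectors of `D̄(φ)` with eigenvalue `χ_k(φ)`. -/
theorem racetrack_cos_sin_eigenvectors (M N : ℕ) (hM : 1 ≤ M) (hN : N = 2 * M)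
    (φ : ℝ) (hφ : φ ∈ Set.Ioo (0 : ℝ) 1) (k : ℕ) (hk1 : 1 ≤ k) (hkM : k ≤ M - 1) :
    (fun i : Fin N => Real.cos (2 * Real.pi / N * k * i)) ≠ 0 ∧
    (fun i : Fin N => Real.sin (2 * Real.pi / N * k * i)) ≠ 0 ∧
    (Dbar N M φ).mulVec (fun i : Fin N => Real.cos (2 * Real.pi / N * k * i)) =
      chi N M k φ • (fun i : Fin N => Real.cos (2 * Real.pi / N * k * i)) ∧
    (Dbar N M φ).mulVec (fun i : Fin N => Real.sin (2 * Real.pi / N * k * i)) =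
      chi N M k φ • (fun i : Fin N => Real.sin (2 * Real.pi / N * k * i)) := by
  subst hN
  have hMr : (M : ℝ) ≠ 0 := by positivity
  refine ⟨?_, ?_, ?_, ?_⟩
  · intro h
    have := congrFun h ⟨0, by omega⟩
    simp at this
  · intro h
    have := congrFun h ⟨1, by omega⟩
    simp only [Nat.cast_one, mul_one, Pi.zero_apply] at this
    refine absurd this (Real.sin_pos_of_pos_of_lt_pi ?_ ?_).ne'
    · have : (0 : ℝ) < k := by exact_mod_cast hk1
      positivity
    · have h2 : (k : ℝ) < M := by exact_mod_cast (by omega : k < M)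
      have h3 : (0 : ℝ) < M := by positivity
      push_cast
      rw [show 2 * Real.pi / (2 * (M : ℝ)) * k = Real.pi * (k / M) by field_simp]
      have : (k : ℝ) / M < 1 := (div_lt_one h3).2 h2
      nlinarith [Real.pi_pos]
  · have := rt_eig M hM φ hφ k (fun n => Real.cos (2 * Real.pi / (2 * M : ℕ) * k * n))
      (by intro n
          push_cast
          rw [mul_add, mul_sub, Real.cos_add, Real.cos_sub, mul_one]
          ring)
      (by intro n
          have : 2 * Real.pi / (2 * M : ℕ) * k * ((n + M : ℤ) : ℝ)
            = 2 * Real.pi / (2 * M : ℕ) * k * n + k * Real.pi := by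
            push_cast
            field_simp
          rw [this, Real.cos_add_nat_mul_pi])
    simpa using this
  · have := rt_eig M hM φ hφ k (fun n => Real.sin (2 * Real.pi / (2 * M : ℕ) * k * n))
      (by intro n
          push_cast
          rw [mul_add, mul_sub, Real.sin_add, Real.sin_sub, mul_one]
          ring)
      (by intro n
          have : 2 * Real.pi / (2 * M : ℕ) * k * ((n + M : ℤ) : ℝ)
            = 2 * Real.pi / (2 * M : ℕ) * k * n + k * Real.pi := by
            push_cast
            field_simp
          rw [this, Real.sin_add_nat_mul_pi])
    simpa using this
end
end

section
/- For every integer N = 2M with M ≥ 1 and every φ ∈ (0,1), the alternating vector z_M = ((−1)^i)_{i=0}^{N−1} satisfies D̄(φ) z_M = χ_M(φ) z_M. Moreover, if N is a multiple of 4 (so M is even), then χ_M(φ) = ((1−φ)/(1+φ))². -/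
open Real Matrix Finset Set

noncomputable section

lemma rdist_add (M : ℕ) [NeZero (2 * M)] (i d : Fin (2 * M)) :
    rdist (2 * M) i (i + d) = min (d : ℕ) (2 * M - d) := by
  have hi := i.isLt
  have hd := d.isLt
  unfold rdist
  rw [Fin.val_add_eq_ite]
  split_ifs <;> omega

lemma sum_min (M : ℕ) (x : ℝ) (hx : 1 - x ≠ 0) :
    ∑ d ∈ Finset.range (2 * M), x ^ (min d (2 * M - d)) = (1 + x) * (1 - x ^ M) / (1 - x) := by
  have h1 : ∑ d ∈ Finset.range (2 * M), x ^ (min d (2 * M - d))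
      = ∑ d ∈ Finset.range M, x ^ d + ∑ d ∈ Finset.range M, x ^ (d + 1) := by
    rw [two_mul, Finset.sum_range_add]
    congr 1
    · apply Finset.sum_congr rfl
      intro d hd
      have := Finset.mem_range.1 hd
      congr 1
      omega
    · rw [← Finset.sum_range_reflect]
      apply Finset.sum_congr rfl
      intro d hd
      have := Finset.mem_range.1 hd
      congr 1
      omega
  have h2 : (1 - x) * ∑ d ∈ Finset.range M, x ^ d = 1 - x ^ M := mul_neg_geom_sum x M
  rw [h1, eq_div_iff hx]
  simp only [pow_succ]
  rw [← Finset.sum_mul]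
  linear_combination (1 + x) * h2

lemma Psi_M (M : ℕ) (hM : 1 ≤ M) (φ : ℝ) (h0 : 0 < φ) :
    Psi (2 * M) M φ = (1 - φ) / (1 + φ) := by
  have hM' : (M : ℝ) ≠ 0 := by positivity
  have h : 2 * Real.pi / ((2 * M : ℕ) : ℝ) * M = Real.pi := by
    push_cast
    field_simp
  have hp : 1 + φ ≠ 0 := by positivity
  unfold Psi
  rw [h, Real.cos_pi]
  have : 1 - 2 * φ * (-1) + φ ^ 2 = (1 + φ) ^ 2 := by ring
  rw [this]
  field_simp
  ring

lemma parity_aux (M : ℕ) [NeZero (2 * M)] (φ : ℝ) (i d : Fin (2 * M)) :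
    φ ^ (min (d : ℕ) (2 * M - d)) * (-1 : ℝ) ^ ((i + d : Fin (2 * M)) : ℕ)
      = (-1) ^ (i : ℕ) * (-φ) ^ (min (d : ℕ) (2 * M - d)) := by
  have hi := i.isLt
  have hd := d.isLt
  have key : (-1 : ℝ) ^ ((i + d : Fin (2 * M)) : ℕ)
      = (-1) ^ ((i : ℕ) + min (d : ℕ) (2 * M - d)) := by
    rw [neg_one_pow_eq_pow_mod_two, neg_one_pow_eq_pow_mod_two (n := (i : ℕ) + _)]
    congr 1
    rw [Fin.val_add_eq_ite]
    split_ifs <;> omega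
  rw [key, neg_pow φ, pow_add]
  ring

/-- For `N = 2M`, `M ≥ 1`, and `φ ∈ (0,1)`, the alternating vector
`z_M = ((−1)^i)_i` is an eigenvector of `D̄(φ)` with eigenvalue `χ_M(φ)`, and if
moreover `N` is a multiple of `4` then `χ_M(φ) = ((1−φ)/(1+φ))²`. -/
theorem racetrack_alternating_eigenvector (M N : ℕ) (hM : 1 ≤ M) (hN : N = 2 * M)
    (φ : ℝ) (hφ : φ ∈ Set.Ioo (0 : ℝ) 1) :
    (Dbar N M φ).mulVec (fun i : Fin N => (-1 : ℝ) ^ (i : ℕ)) =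
      chi N M M φ • (fun i : Fin N => (-1 : ℝ) ^ (i : ℕ)) ∧
    (4 ∣ N → chi N M M φ = ((1 - φ) / (1 + φ)) ^ 2) := by
  subst hN
  obtain ⟨h0, h1⟩ := hφ
  have : NeZero (2 * M) := ⟨by omega⟩
  have hPsi := Psi_M M hM φ h0
  have hp : 1 + φ ≠ 0 := by positivity
  have hm : 1 - φ ≠ 0 := by linarith
  have hpow : φ ^ M < 1 := pow_lt_one₀ h0.le h1 (by omega)
  have hpm : 1 - φ ^ M ≠ 0 := by linarith
  have hchi : chi (2 * M) M M φ
      = (Srow M φ)⁻¹ * ((1 + -φ) * (1 - (-φ) ^ M) / (1 - -φ)) := by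
    unfold chi Srow PsiBar
    rw [hPsi, sub_neg_eq_add]
    split_ifs with he
    · rw [he.neg_pow]
      field_simp
      ring
    · rw [(Nat.not_even_iff_odd.1 he).neg_pow]
      field_simp
      ring
  refine ⟨?_, ?_⟩
  · funext i
    rw [hchi, ← sum_min M (-φ) (by rwa [sub_neg_eq_add]), Dbar, Matrix.smul_mulVec]
    simp only [Pi.smul_apply, smul_eq_mul]
    rw [mul_assoc]
    congr 1
    simp only [Matrix.mulVec, dotProduct, Dmat, Matrix.of_apply]
    rw [← Equiv.sum_comp (Equiv.addLeft i)]
    simp only [Equiv.coe_addLeft, rdist_add, parity_aux]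
    rw [← Finset.mul_sum, mul_comm,
      ← Fin.sum_univ_eq_sum_range (fun d => (-φ) ^ (min d (2 * M - d)))]
  · intro h4
    have he : Even M := by
      rw [even_iff_two_dvd]
      omega
    unfold chi
    rw [if_pos he, hPsi, sq]
end
end

section
/- For every integer N = 2M with M ≥ 1 and every k with 1 ≤ k ≤ M, the function φ ↦ χ_k(φ) is differentiable and strictly decreasing on (0,1), and χ_k(φ) → 1 as φ → 0⁺ and χ_k(φ) → 0 as φ → 1⁻. -/
open Real Matrix Finset Set

noncomputable section

lemma geom_aux (r : ℝ) (hr : 0 < r) (m : ℕ) :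
    (m : ℝ) * r ^ m ≤ r * ∑ i ∈ Finset.range m, (r ^ 2) ^ i := by
  induction m using Nat.twoStepInduction with
  | zero => simp
  | one => simp
  | more n ih _ =>
    rw [Finset.sum_range_succ, Finset.sum_range_succ']
    have e : ∑ i ∈ Finset.range n, (r ^ 2) ^ (i + 1)
        = r ^ 2 * ∑ i ∈ Finset.range n, (r ^ 2) ^ i := by
      rw [Finset.mul_sum]
      exact Finset.sum_congr rfl fun i _ => by ring
    rw [e]
    have h1 : r ^ 2 * ((n : ℝ) * r ^ n) ≤ r ^ 2 * (r * ∑ i ∈ Finset.range n, (r ^ 2) ^ i) :=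
      mul_le_mul_of_nonneg_left ih (by positivity)
    have h2 : 0 ≤ r * (1 - r ^ (n + 1)) ^ 2 := by positivity
    have e2 : (r ^ 2) ^ (n + 1) = (r ^ (n + 1)) ^ 2 := by rw [← pow_mul, ← pow_mul, mul_comm]
    have e3 : r ^ (n + 2) = r * r ^ (n + 1) := by ring
    have e4 : r ^ 2 * ((n : ℝ) * r ^ n) = n * (r * r ^ (n + 1)) := by ring
    rw [e2, e3]
    rw [e4] at h1
    push_cast
    simp only [pow_zero]
    nlinarith

lemma one_sub_pow_sq (x : ℝ) (hx : 0 < x) (m : ℕ) :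
    (m : ℝ) ^ 2 * x ^ m * (1 - x) ^ 2 ≤ x * (1 - x ^ m) ^ 2 := by
  have h := geom_aux (√x) (Real.sqrt_pos.2 hx) m
  have hs : (√x) ^ 2 = x := Real.sq_sqrt hx.le
  rw [hs] at h
  have h2 := pow_le_pow_left₀ (by positivity) h 2
  have e : ((m : ℝ) * √x ^ m) ^ 2 = (m : ℝ) ^ 2 * x ^ m := by
    rw [mul_pow, ← pow_mul, mul_comm m 2, pow_mul, hs]
  rw [e, mul_pow, hs] at h2
  have g := mul_neg_geom_sum x m
  rw [← g]
  calc _ ≤ x * (∑ i ∈ Finset.range m, x ^ i) ^ 2 * (1 - x) ^ 2 :=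
        mul_le_mul_of_nonneg_right h2 (by positivity)
    _ = _ := by ring

/-- key lower bound, with `M = n + 1` -/
lemma T_bound (x : ℝ) (hx : 0 < x) (n : ℕ) :
    4 * ((n : ℝ) + 1) * x ^ (n + 1) +
      x ^ n * (1 - x) ^ 2 * (((n : ℝ) + 1) * (2 * ((n : ℝ) + 1) ^ 2 + 1) / 3)
      ≤ (1 + x) * ∑ i ∈ Finset.range (2 * (n + 1)), x ^ i := by
  induction n with
  | zero =>
    simp [Finset.sum_range_succ]
    nlinarith
  | succ n ih =>
    rw [show 2 * (n + 1 + 1) = 2 * (n + 1) + 1 + 1 by ring, Finset.sum_range_succ,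
      Finset.sum_range_succ']
    have e : ∑ i ∈ Finset.range (2 * (n + 1)), x ^ (i + 1)
        = x * ∑ i ∈ Finset.range (2 * (n + 1)), x ^ i := by
      rw [Finset.mul_sum]
      exact Finset.sum_congr rfl fun i _ => by ring
    rw [e]
    have ih' := mul_le_mul_of_nonneg_left ih hx.le
    have h1 := one_sub_pow_sq x hx (n + 1)
    have h2 := one_sub_pow_sq x hx (n + 2)
    have h2' : ((n + 2 : ℕ) : ℝ) ^ 2 * x ^ (n + 1) * (1 - x) ^ 2 ≤ (1 - x ^ (n + 2)) ^ 2 := by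
      refine le_of_mul_le_mul_left ?_ hx
      calc _ = ((n + 2 : ℕ) : ℝ) ^ 2 * x ^ (n + 2) * (1 - x) ^ 2 := by ring
        _ ≤ _ := h2
    push_cast at h1 h2' ⊢
    have key := add_le_add (add_le_add ih' h1) h2'
    refine le_trans (le_of_eq ?_) ((add_le_add_left key (4 * x ^ (n + 2))).trans (le_of_eq ?_))
    · ring
    · ring

lemma numer_neg (x a : ℝ) (hx : 0 < x) (n : ℕ) (ha : 4 ≤ a * ((n : ℝ) + 1) ^ 2) :
    2 * ((1 - x) ^ 2 + a * x) * ((n : ℝ) + 1) * x ^ n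
      < a * ((1 + x) * ∑ i ∈ Finset.range (2 * (n + 1)), x ^ i) := by
  have hn : (0 : ℝ) < (n : ℝ) + 1 := by positivity
  have ha0 : 0 < a := by
    by_contra h
    push Not at h
    nlinarith [mul_nonneg (neg_nonneg.2 h) (sq_nonneg ((n : ℝ) + 1))]
  have h := mul_le_mul_of_nonneg_left (T_bound x hx n) ha0.le
  refine lt_of_lt_of_le ?_ h
  have hp : 0 < x ^ n := by positivity
  have hq : 0 ≤ x ^ n * (1 - x) ^ 2 * ((n : ℝ) + 1) := by positivity
  have h3 := mul_le_mul_of_nonneg_left ha hq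
  have h4 : 0 < a * ((n : ℝ) + 1) * x ^ n * x := by positivity
  have h5 : 0 ≤ a * (x ^ n * (1 - x) ^ 2 * ((n : ℝ) + 1)) := by positivity
  rw [pow_succ x n]
  nlinarith

/-- closed forms -/
def evF (a x : ℝ) : ℝ := (1 - x) ^ 2 / ((1 - x) ^ 2 + a * x)

def odF (a : ℝ) (n : ℕ) (x : ℝ) : ℝ :=
  ((1 - x) ^ 2 * (1 + x ^ (n + 1))) / (((1 - x) ^ 2 + a * x) * (1 - x ^ (n + 1)))

def odG (a : ℝ) (n : ℕ) (x : ℝ) : ℝ :=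
  ((1 - x) * (1 + x ^ (n + 1))) /
    (((1 - x) ^ 2 + a * x) * ∑ i ∈ Finset.range (n + 1), x ^ i)

lemma evF_deriv (a x : ℝ) (ha : 0 < a) (hx : x ∈ Set.Ioo (0 : ℝ) 1) :
    ∃ d < 0, HasDerivAt (evF a) d x := by
  obtain ⟨h0, h1⟩ := hx
  have hC : 0 < (1 - x) ^ 2 + a * x := by positivity
  have hA : HasDerivAt (fun x : ℝ => (1 - x) ^ 2) (-(2 * (1 - x))) x := by
    exact (((hasDerivAt_id' x).const_sub 1).fun_pow 2).congr_deriv (by norm_num)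
  have hCd : HasDerivAt (fun x : ℝ => (1 - x) ^ 2 + a * x) (-(2 * (1 - x)) + a) x := by
    exact (hA.fun_add ((hasDerivAt_id' x).const_mul a)).congr_deriv (by norm_num)
  refine ⟨_, ?_, hA.div hCd hC.ne'⟩
  apply div_neg_of_neg_of_pos _ (by positivity)
  have : 0 < (1 - x) * a * (1 + x) := by
    have := sub_pos.2 h1
    positivity
  nlinarith

lemma odF_deriv (a x : ℝ) (n : ℕ) (ha : 4 ≤ a * ((n : ℝ) + 1) ^ 2) (ha0 : 0 < a)
    (hx : x ∈ Set.Ioo (0 : ℝ) 1) :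
    ∃ d < 0, HasDerivAt (odF a n) d x := by
  obtain ⟨h0, h1⟩ := hx
  have hC : 0 < (1 - x) ^ 2 + a * x := by positivity
  have hD : 0 < 1 - x ^ (n + 1) := sub_pos.2 (pow_lt_one₀ h0.le h1 (by omega))
  have hA : HasDerivAt (fun x : ℝ => (1 - x) ^ 2) (-(2 * (1 - x))) x := by
    exact (((hasDerivAt_id' x).const_sub 1).fun_pow 2).congr_deriv (by norm_num)
  have hCd : HasDerivAt (fun x : ℝ => (1 - x) ^ 2 + a * x) (-(2 * (1 - x)) + a) x := by
    exact (hA.fun_add ((hasDerivAt_id' x).const_mul a)).congr_deriv (by norm_num)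
  have hP : HasDerivAt (fun x : ℝ => x ^ (n + 1)) (((n : ℝ) + 1) * x ^ n) x := by
    simpa using hasDerivAt_pow (n + 1) x
  refine ⟨_, ?_, (hA.mul (hP.const_add 1)).div (hCd.mul (hP.const_sub 1)) (mul_pos hC hD).ne'⟩
  apply div_neg_of_neg_of_pos _ (pow_pos (mul_pos hC hD) 2)
  have hk := numer_neg x a h0 n ha
  have hS := mul_neg_geom_sum x (2 * (n + 1))
  have hx2 : 0 < (1 - x) ^ 2 := by
    have := sub_pos.2 h1
    positivity
  have h := mul_pos hx2 (sub_pos.2 hk)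
  have e : (1 - x) ^ 2 * (a * ((1 + x) * ∑ i ∈ Finset.range (2 * (n + 1)), x ^ i)
      - 2 * ((1 - x) ^ 2 + a * x) * ((n : ℝ) + 1) * x ^ n)
      = (1 - x) * a * (1 + x) * (1 - x ^ (2 * (n + 1)))
      - 2 * (1 - x) ^ 2 * ((1 - x) ^ 2 + a * x) * ((n : ℝ) + 1) * x ^ n := by
    rw [← hS]; ring
  rw [e] at h
  refine lt_of_eq_of_lt ?_ (neg_lt_zero.2 h)
  simp only [Pi.mul_apply]
  ring

lemma wrap (f F G : ℝ → ℝ) (hfF : ∀ x ∈ Set.Ioo (0 : ℝ) 1, f x = F x)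
    (hfG : ∀ x ∈ Set.Ioo (0 : ℝ) 1, f x = G x)
    (hd : ∀ x ∈ Set.Ioo (0 : ℝ) 1, ∃ d < 0, HasDerivAt F d x)
    (c0 : ContinuousAt F 0) (v0 : F 0 = 1) (c1 : ContinuousAt G 1) (v1 : G 1 = 0) :
    (∀ φ ∈ Set.Ioo (0 : ℝ) 1, DifferentiableAt ℝ f φ) ∧
    StrictAntiOn f (Set.Ioo (0 : ℝ) 1) ∧
    Filter.Tendsto f (nhdsWithin 0 (Set.Ioi 0)) (nhds 1) ∧
    Filter.Tendsto f (nhdsWithin 1 (Set.Iio 1)) (nhds 0) := by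
  have hd' : ∀ x ∈ Set.Ioo (0 : ℝ) 1, ∃ d < 0, HasDerivAt f d x := by
    intro x hx
    obtain ⟨d, h, hh⟩ := hd x hx
    refine ⟨d, h, hh.congr_of_eventuallyEq ?_⟩
    filter_upwards [isOpen_Ioo.mem_nhds hx] with y hy using hfF y hy
  refine ⟨fun x hx => ?_, ?_, ?_, ?_⟩
  · obtain ⟨d, _, hh⟩ := hd' x hx
    exact hh.differentiableAt
  · apply strictAntiOn_of_deriv_neg (convex_Ioo 0 1)
    · intro x hx
      obtain ⟨d, _, hh⟩ := hd' x hx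
      exact hh.continuousAt.continuousWithinAt
    · intro x hx
      rw [interior_Ioo] at hx
      obtain ⟨d, h, hh⟩ := hd' x hx
      rwa [hh.deriv]
  · have := (c0.tendsto.mono_left (nhdsWithin_le_nhds (s := Set.Ioi 0)))
    rw [v0] at this
    refine this.congr' ?_
    filter_upwards [Ioo_mem_nhdsGT (zero_lt_one' ℝ)] with y hy using (hfF y hy).symm
  · have := (c1.tendsto.mono_left (nhdsWithin_le_nhds (s := Set.Iio 1)))
    rw [v1] at this
    refine this.congr' ?_
    filter_upwards [Ioo_mem_nhdsLT (zero_lt_one' ℝ)] with y hy using (hfG y hy).symm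

/-- For `N = 2M`, `M ≥ 1`, and `1 ≤ k ≤ M`, the map `φ ↦ χ_k(φ)` is differentiable
and strictly decreasing on `(0,1)`, tends to `1` as `φ → 0⁺`, and tends to `0` as
`φ → 1⁻`. -/
theorem chi_strictAnti_and_limits (M N : ℕ) (hM : 1 ≤ M) (hN : N = 2 * M)
    (k : ℕ) (hk1 : 1 ≤ k) (hkM : k ≤ M) :
    (∀ φ ∈ Set.Ioo (0 : ℝ) 1, DifferentiableAt ℝ (chi N M k) φ) ∧
    StrictAntiOn (chi N M k) (Set.Ioo (0 : ℝ) 1) ∧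
    Filter.Tendsto (chi N M k) (nhdsWithin 0 (Set.Ioi 0)) (nhds 1) ∧
    Filter.Tendsto (chi N M k) (nhdsWithin 1 (Set.Iio 1)) (nhds 0) := by
  obtain ⟨n, rfl⟩ : ∃ n, M = n + 1 := ⟨M - 1, by omega⟩
  subst hN
  have hn : (0 : ℝ) < (n : ℝ) + 1 := by positivity
  set c := Real.cos (2 * Real.pi / ((2 * (n + 1) : ℕ) : ℝ) * k) with hc
  have hcM : Real.cos (2 * Real.pi / ((2 * (n + 1) : ℕ) : ℝ) * ((n + 1 : ℕ) : ℝ)) = -1 := by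
    rw [← Real.cos_pi]
    congr 1
    push_cast
    field_simp
  obtain ⟨a, ha⟩ : ∃ a, a = 2 - 2 * c := ⟨_, rfl⟩
  have ha4 : 4 ≤ a * ((n : ℝ) + 1) ^ 2 := by
    have hk1' : (1 : ℝ) ≤ k := by exact_mod_cast hk1
    have hkM' : (k : ℝ) ≤ (n : ℝ) + 1 := by exact_mod_cast hkM
    have e : 2 * Real.pi / ((2 * (n + 1) : ℕ) : ℝ) * k = Real.pi * (k / ((n : ℝ) + 1)) := by
      push_cast
      field_simp
    have hle : |Real.pi * (k / ((n : ℝ) + 1))| ≤ Real.pi := by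
      rw [abs_of_nonneg (by positivity)]
      exact mul_le_of_le_one_right Real.pi_pos.le ((div_le_one hn).2 hkM')
    have hq := Real.cos_le_one_sub_mul_cos_sq hle
    rw [← e, ← hc] at hq
    have e2 : 2 / Real.pi ^ 2 * (2 * Real.pi / ((2 * (n + 1) : ℕ) : ℝ) * k) ^ 2
        = 2 * k ^ 2 / ((n : ℝ) + 1) ^ 2 := by
      rw [e]
      have := Real.pi_pos
      field_simp
    rw [e2] at hq
    have h4 : 4 * (k : ℝ) ^ 2 / ((n : ℝ) + 1) ^ 2 ≤ a := by
      rw [ha]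
      have : 4 * (k : ℝ) ^ 2 / ((n : ℝ) + 1) ^ 2 = 2 * (2 * k ^ 2 / ((n : ℝ) + 1) ^ 2) := by ring
      linarith
    rw [div_le_iff₀ (by positivity)] at h4
    nlinarith
  have ha0 : 0 < a := by
    by_contra h
    push Not at h
    nlinarith [mul_nonneg (neg_nonneg.2 h) (sq_nonneg ((n : ℝ) + 1))]
  have hev : ∀ x ∈ Set.Ioo (0 : ℝ) 1,
      Psi (2 * (n + 1)) k x * Psi (2 * (n + 1)) (n + 1) x = evF a x := by
    rintro x ⟨h0, h1⟩
    have hC : 0 < (1 - x) ^ 2 + a * x := by positivity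
    have eC : 1 - 2 * x * c + x ^ 2 = (1 - x) ^ 2 + a * x := by rw [ha]; ring
    unfold Psi evF
    rw [hcM, ← hc, eC, div_mul_div_comm,
      show 1 - 2 * x * (-1) + x ^ 2 = (1 + x) ^ 2 by ring,
      show (1 - x ^ 2) * (1 - x ^ 2) = (1 - x) ^ 2 * (1 + x) ^ 2 by ring]
    exact mul_div_mul_right _ _ (by positivity)
  by_cases hk : Even k
  · have hf : ∀ x ∈ Set.Ioo (0 : ℝ) 1, chi (2 * (n + 1)) (n + 1) k x = evF a x := by
      intro x hx
      rw [chi, if_pos hk, hev x hx]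
    refine wrap _ (evF a) (evF a) hf hf (fun x hx => evF_deriv a x ha0 hx) ?_ ?_ ?_ ?_
    · unfold evF
      exact ContinuousAt.div (by fun_prop) (by fun_prop) (by simp)
    · simp [evF]
    · unfold evF
      exact ContinuousAt.div (by fun_prop) (by fun_prop) (by simp [ha0.ne'])
    · simp [evF]
  · have hf : ∀ x ∈ Set.Ioo (0 : ℝ) 1, chi (2 * (n + 1)) (n + 1) k x = odF a n x := by
      intro x hx
      rw [chi, if_neg hk, hev x hx, evF, PsiBar, odF, div_mul_div_comm]
    have hg : ∀ x ∈ Set.Ioo (0 : ℝ) 1, chi (2 * (n + 1)) (n + 1) k x = odG a n x := by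
      intro x hx
      rw [hf x hx, odF, odG, ← mul_neg_geom_sum x (n + 1)]
      have h1 : 1 - x ≠ 0 := (sub_pos.2 hx.2).ne'
      rw [← mul_div_mul_left ((1 - x) * (1 + x ^ (n + 1))) _ h1]
      congr 1 <;> ring
    refine wrap _ (odF a n) (odG a n) hf hg (fun x hx => odF_deriv a x n ha4 ha0 hx) ?_ ?_ ?_ ?_
    · unfold odF
      exact ContinuousAt.div (by fun_prop) (by fun_prop) (by simp)
    · simp [odF]
    · unfold odG
      refine ContinuousAt.div (by fun_prop) (by fun_prop) ?_
      simp [ha0.ne']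
      exact hn.ne'
    · simp [odG]
end
end

section
/- For every integer N = 2M with M ≥ 2 and every fixed φ ∈ (0,1): χ_0(φ) = 1; the values χ_k(φ) for even indices k are strictly decreasing in k and positive, i.e. 1 = χ_0(φ) > χ_2(φ) > χ_4(φ) > ⋯ > 0 (even k ≤ M); the values for odd indices satisfy 1 > χ_1(φ) > χ_3(φ) > ⋯ > 0 (odd k ≤ M); and χ_0(φ) > χ_1(φ) > χ_2(φ). Consequently, max_{1 ≤ k ≤ M} χ_k(φ) = χ_1(φ) and min_{1 ≤ k ≤ M} χ_k(φ) = min{χ_{M−1}(φ), χ_M(φ)}. -/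
open Real Matrix Finset Set

noncomputable section

theorem aux_binom (v : ℝ) (hv : 0 < v) (M : ℕ) :
    1 + M * v + M * (M - 1) / 2 * v ^ 2 ≤ (1 + v) ^ M := by
  induction M with
  | zero => simp
  | succ n ih =>
    rw [pow_succ]
    have h := mul_le_mul_of_nonneg_right ih (by linarith : (0:ℝ) ≤ 1 + v)
    refine le_trans ?_ h
    push_cast
    have h3 : (0:ℝ) ≤ n * (n - 1) := by
      rcases Nat.eq_zero_or_pos n with h | h
      · simp [h]
      · have : (1:ℝ) ≤ n := by exact_mod_cast h
        exact mul_nonneg (by linarith) (by linarith)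
    have h4 : (0:ℝ) ≤ n * (n - 1) * v ^ 3 := mul_nonneg h3 (by positivity)
    nlinarith

theorem aux_cos (M : ℕ) (hM : 2 ≤ M) : 2 / (M:ℝ) ^ 2 ≤ 1 - Real.cos (Real.pi / M) := by
  have hM' : (2:ℝ) ≤ M := by exact_mod_cast hM
  have hp := Real.pi_pos
  have h := Real.cos_le_one_sub_mul_cos_sq (x := Real.pi / M) (by
    rw [abs_of_pos (by positivity)]
    exact div_le_self hp.le (by linarith))
  have : 2 / Real.pi ^ 2 * (Real.pi / M) ^ 2 = 2 / (M:ℝ) ^ 2 := by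
    field_simp
  linarith

theorem aux_key (M : ℕ) (hM : 2 ≤ M) (φ : ℝ) (h0 : 0 < φ) (h1 : φ < 1) :
    φ ^ M * (1 - φ) ^ 2 < φ * (1 - φ ^ M) * (1 - Real.cos (Real.pi / M)) := by
  have hM' : (2:ℝ) ≤ M := by exact_mod_cast hM
  have hc := aux_cos M hM
  obtain ⟨v, hv⟩ : ∃ v, v = φ⁻¹ - 1 := ⟨_, rfl⟩
  have hv0 : 0 < v := by
    have := (one_lt_inv₀ h0).2 h1
    linarith
  have hb := aux_binom v hv0 M
  set P := (1 + v) ^ M with hP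
  set d := 1 - Real.cos (Real.pi / M) with hd
  have e1 : φ * (1 + v) = 1 := by rw [hv]; field_simp; ring
  have e2 : φ ^ M * P = 1 := by rw [hP, ← mul_pow, e1, one_pow]
  have hA : (M * v + M * (M - 1) / 2 * v ^ 2) * (2 / (M:ℝ) ^ 2) ≤ (P - 1) * d := by
    apply mul_le_mul (by linarith) hc (by positivity)
    have : 0 ≤ (M:ℝ) * v + M * (M - 1) / 2 * v ^ 2 := by
      have : (0:ℝ) ≤ M - 1 := by linarith
      positivity
    linarith
  have hA' : v ^ 2 / (1 + v) < (M * v + M * (M - 1) / 2 * v ^ 2) * (2 / (M:ℝ) ^ 2) := by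
    have : (M * v + M * (M - 1) / 2 * v ^ 2) * (2 / (M:ℝ) ^ 2) = v * (2 + (M - 1) * v) / M := by
      field_simp
    rw [this, div_lt_div_iff₀ (by linarith) (by linarith)]
    have : (0:ℝ) < M - 1 := by linarith
    have : 0 < v * (2 + v + (M - 1) * v ^ 2) := by positivity
    nlinarith
  have hB := lt_of_lt_of_le hA' hA
  have hq : 0 < φ ^ M * φ := by positivity
  have hC := mul_lt_mul_of_pos_left hB hq
  have e3 : φ ^ M * φ * (v ^ 2 / (1 + v)) = φ ^ M * (1 - φ) ^ 2 := by
    have : v = (1 - φ) / φ := by rw [hv]; field_simp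
    have h5 : 1 + v = 1 / φ := by rw [hv]; field_simp; ring
    rw [h5, this]; field_simp
  have e4 : φ ^ M * φ * ((P - 1) * d) = φ * (1 - φ ^ M) * d := by
    linear_combination φ * d * e2
  rwa [e3, e4] at hC

theorem aux_den (φ c : ℝ) (h0 : 0 < φ) (h1 : φ < 1) (hc : c ≤ 1) :
    0 < 1 - 2 * φ * c + φ ^ 2 := by
  nlinarith [mul_le_mul_of_nonneg_left hc h0.le, mul_pos (sub_pos.2 h1) (sub_pos.2 h1)]

theorem aux_Psi_pos (N k : ℕ) (φ : ℝ) (h0 : 0 < φ) (h1 : φ < 1) : 0 < Psi N k φ := by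
  unfold Psi
  exact div_pos (by nlinarith) (aux_den φ _ h0 h1 (Real.cos_le_one _))

theorem aux_Psi_lt (M k k' : ℕ) (hM : 2 ≤ M) (φ : ℝ) (h0 : 0 < φ) (h1 : φ < 1)
    (hk : k < k') (hk' : k' ≤ M) : Psi (2 * M) k' φ < Psi (2 * M) k φ := by
  unfold Psi
  have hp := Real.pi_pos
  have hM' : (2:ℝ) ≤ M := by exact_mod_cast hM
  have hk1 : (k:ℝ) < k' := by exact_mod_cast hk
  have hk2 : (k':ℝ) ≤ M := by exact_mod_cast hk'
  have e : 2 * Real.pi / ((2 * M : ℕ) : ℝ) = Real.pi / M := by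
    push_cast; field_simp
  rw [e]
  have hpos : 0 < Real.pi / M := by positivity
  have hc : Real.cos (Real.pi / M * k') < Real.cos (Real.pi / M * k) := by
    apply Real.cos_lt_cos_of_nonneg_of_le_pi (by positivity)
    · calc Real.pi / M * k' ≤ Real.pi / M * M := by gcongr
        _ = Real.pi := by field_simp
    · gcongr
  apply div_lt_div_of_pos_left (by nlinarith) (aux_den φ _ h0 h1 (Real.cos_le_one _))
  nlinarith

theorem aux_Psi_zero (N : ℕ) (φ : ℝ) (h0 : 0 < φ) (h1 : φ < 1) :
    Psi N 0 φ = (1 + φ) / (1 - φ) := by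
  unfold Psi
  have : (1 - φ) ≠ 0 := by linarith
  have e : 1 - 2 * φ * Real.cos (2 * Real.pi / N * (0:ℕ)) + φ ^ 2 = (1 - φ) ^ 2 := by
    simp; ring
  rw [e]; field_simp; ring

theorem aux_Psi_M (M : ℕ) (hM : 2 ≤ M) (φ : ℝ) (h0 : 0 < φ) :
    Psi (2 * M) M φ = (1 - φ) / (1 + φ) := by
  unfold Psi
  have hM' : (2:ℝ) ≤ M := by exact_mod_cast hM
  have e0 : 2 * Real.pi / ((2 * M : ℕ) : ℝ) * M = Real.pi := by
    push_cast; field_simp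
  have e : 1 - 2 * φ * Real.cos (2 * Real.pi / ((2 * M : ℕ) : ℝ) * M) + φ ^ 2 = (1 + φ) ^ 2 := by
    rw [e0]; simp; ring
  rw [e]; field_simp; ring

theorem aux_PsiBar (M : ℕ) (hM : 2 ≤ M) (φ : ℝ) (h0 : 0 < φ) (h1 : φ < 1) :
    1 < PsiBar M φ := by
  unfold PsiBar
  have : φ ^ M < 1 := pow_lt_one₀ h0.le h1 (by omega)
  have : 0 < φ ^ M := by positivity
  rw [one_lt_div (by linarith)]
  linarith

theorem aux_one (M : ℕ) (hM : 2 ≤ M) (φ : ℝ) (h0 : 0 < φ) (h1 : φ < 1) :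
    Psi (2 * M) 1 φ * Psi (2 * M) M φ * PsiBar M φ < 1 := by
  rw [aux_Psi_M M hM φ h0]
  have hk := aux_key M hM φ h0 h1
  have hd := aux_den φ _ h0 h1 (Real.cos_le_one (Real.pi / M))
  have e : 2 * Real.pi / ((2 * M : ℕ) : ℝ) * (1 : ℕ) = Real.pi / M := by
    push_cast; field_simp
  have hx : φ ^ M < 1 := pow_lt_one₀ h0.le h1 (by omega)
  unfold Psi PsiBar
  rw [e]
  generalize Real.cos (Real.pi / M) = c at *
  generalize φ ^ M = x at *
  have : (1 - φ ^ 2) / (1 - 2 * φ * c + φ ^ 2) * ((1 - φ) / (1 + φ)) * ((1 + x) / (1 - x))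
      = ((1 - φ) ^ 2 * (1 + x)) / ((1 - 2 * φ * c + φ ^ 2) * (1 - x)) := by
    have : 1 - x ≠ 0 := by linarith
    field_simp
    ring
  rw [this, div_lt_one (mul_pos hd (by linarith))]
  nlinarith

/-- For `N = 2M`, `M ≥ 2`, and fixed `φ ∈ (0,1)`: `χ_0(φ) = 1`; all `χ_k(φ)`
(`1 ≤ k ≤ M`) are positive; the even-indexed values are strictly decreasing in `k`;
`χ_1(φ) < 1` and the odd-indexed values are strictly decreasing in `k`;
`χ_0(φ) > χ_1(φ) > χ_2(φ)`; consequently `χ_1(φ)` is the maximum of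
`{χ_k(φ) : 1 ≤ k ≤ M}` and `min{χ_{M−1}(φ), χ_M(φ)}` is its minimum. -/
theorem chi_interlacing_order (M N : ℕ) (hM : 2 ≤ M) (hN : N = 2 * M)
    (φ : ℝ) (hφ : φ ∈ Set.Ioo (0 : ℝ) 1) :
    chi N M 0 φ = 1 ∧
    (∀ k, 1 ≤ k → k ≤ M → 0 < chi N M k φ) ∧
    (∀ k k', Even k → Even k' → k < k' → k' ≤ M → chi N M k' φ < chi N M k φ) ∧
    chi N M 1 φ < 1 ∧
    (∀ k k', Odd k → Odd k' → k < k' → k' ≤ M → chi N M k' φ < chi N M k φ) ∧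
    chi N M 1 φ < chi N M 0 φ ∧ chi N M 2 φ < chi N M 1 φ ∧
    (∀ k, 1 ≤ k → k ≤ M → chi N M k φ ≤ chi N M 1 φ) ∧
    (∀ k, 1 ≤ k → k ≤ M → min (chi N M (M - 1) φ) (chi N M M φ) ≤ chi N M k φ) := by
  subst hN
  obtain ⟨h0, h1⟩ := hφ
  have hpos := fun k => aux_Psi_pos (2 * M) k φ h0 h1
  have hlt := fun k k' => aux_Psi_lt M k k' hM φ h0 h1
  have hbar := aux_PsiBar M hM φ h0 h1
  have hbar0 : 0 < PsiBar M φ := by linarith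
  have hz : chi (2 * M) M 0 φ = 1 := by
    have h2 : 1 - φ ≠ 0 := by linarith
    have h3 : 1 + φ ≠ 0 := by linarith
    simp only [chi, Even.zero, if_true]
    rw [aux_Psi_zero _ φ h0 h1, aux_Psi_M M hM φ h0]
    field_simp
  have hE : ∀ k k', Even k → Even k' → k < k' → k' ≤ M →
      chi (2 * M) M k' φ < chi (2 * M) M k φ := by
    intro k k' hk hk' hl hm
    simp only [chi, hk, hk', if_true]
    exact mul_lt_mul_of_pos_right (hlt k k' hl hm) (hpos M)
  have hO : ∀ k k', Odd k → Odd k' → k < k' → k' ≤ M →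
      chi (2 * M) M k' φ < chi (2 * M) M k φ := by
    intro k k' hk hk' hl hm
    simp only [chi, Nat.not_even_iff_odd.2 hk, Nat.not_even_iff_odd.2 hk', if_false]
    exact mul_lt_mul_of_pos_right
      (mul_lt_mul_of_pos_right (hlt k k' hl hm) (hpos M)) hbar0
  have hone : chi (2 * M) M 1 φ < 1 := by
    simp only [chi, Nat.not_even_one, if_false]
    exact aux_one M hM φ h0 h1
  have hE1 : ∀ k, Even k → 1 < k → k ≤ M → chi (2 * M) M k φ < chi (2 * M) M 1 φ := by
    intro k hk hl hm
    simp only [chi, hk, Nat.not_even_one, if_true, if_false]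
    have h2 := mul_lt_mul_of_pos_right (hlt 1 k hl hm) (hpos M)
    have h3 := mul_pos (hpos 1) (hpos M)
    nlinarith
  refine ⟨hz, ?_, hE, hone, hO, by rw [hz]; exact hone,
    hE1 2 even_two (by norm_num) hM, ?_, ?_⟩
  · intro k _ _
    have := hpos k
    have := hpos M
    unfold chi
    split_ifs <;> positivity
  · intro k hk hm
    rcases Nat.eq_or_lt_of_le hk with h | h
    · rw [← h]
    · rcases Nat.even_or_odd k with he | ho
      · exact (hE1 k he h hm).le
      · exact (hO 1 k odd_one ho h hm).le
  · intro k hk hm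
    have hsame : ∀ j, j ≤ M → k ≤ j → (Even k ↔ Even j) →
        chi (2 * M) M j φ ≤ chi (2 * M) M k φ := by
      intro j hj hkj hp
      rcases Nat.eq_or_lt_of_le hkj with h | h
      · rw [h]
      · rcases Nat.even_or_odd k with he | ho
        · exact (hE k j he (hp.1 he) h hj).le
        · refine (hO k j ho ?_ h hj).le
          rw [← Nat.not_even_iff_odd] at ho ⊢
          exact fun h => ho (hp.2 h)
    by_cases hp : Even k ↔ Even M
    · exact le_trans (min_le_right _ _) (hsame M le_rfl hm hp)
    · refine le_trans (min_le_left _ _) (hsame (M - 1) (by omega) ?_ ?_)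
      · by_contra hcon
        have : k = M := by omega
        exact hp (by rw [this])
      · rw [Nat.even_sub (by omega)]
        simp only [Nat.not_even_one]
        tauto
end
end

section
/- (Class I / Proposition 1(a), spectral form.) Let N be a multiple of 4 with M = N/2, and let χ_k(φ) for k = 1,…,M be as defined. Let G : [0,1] → ℝ be continuous, and suppose there exists χ* ∈ (0,1) such that G(χ) > 0 for all χ ∈ (0,χ*), G(χ*) = 0, and G(χ) < 0 for all χ ∈ (χ*,1). Set φ* := (1−√χ*)/(1+√χ*) ∈ (0,1). Then: (i) for every φ ∈ (0,φ*) and every k ∈ {1,…,M}, G(χ_k(φ)) < 0 (the uniform distribution is stable); and (ii) for every φ ∈ (φ*,1), G(χ_M(φ)) > 0 (the uniform distribution is unstable in the (N/2)-modal direction). -/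
open Real Matrix Finset Set

noncomputable section

theorem aux_geom (s : ℝ) (hs : 0 ≤ s) (m : ℕ) :
    (2 * m : ℝ) * s ^ (2 * m) ≤ s * ∑ i ∈ Finset.range (2 * m), (s ^ 2) ^ i := by
  induction m with
  | zero => simp
  | succ m ih =>
    rw [show 2 * (m + 1) = (2 * m + 1) + 1 by ring, Finset.sum_range_succ,
      Finset.sum_range_succ']
    simp only [pow_succ (s ^ 2), ← Finset.sum_mul]
    have e : (s ^ 2) ^ (2 * m) = (s ^ (2 * m)) ^ 2 := by ring
    rw [e]
    push_cast
    simp only [pow_succ s (2 * m + 1), pow_succ s (2 * m)]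
    generalize s ^ (2 * m) = p at *
    generalize (∑ i ∈ Finset.range (2 * m), (s ^ 2) ^ i) = S at *
    have h1 := mul_le_mul_of_nonneg_right ih (sq_nonneg s)
    have h2 := mul_nonneg hs (sq_nonneg (1 - p * s))
    simp only [pow_zero]
    nlinarith

theorem aux_geom2 (φ : ℝ) (h0 : 0 ≤ φ) (m : ℕ) :
    (2 * m : ℝ) ^ 2 * φ ^ (2 * m) * (1 - φ) ^ 2 ≤ φ * (1 - φ ^ (2 * m)) ^ 2 := by
  have h := aux_geom (√φ) (Real.sqrt_nonneg _) m
  have hsq := Real.sq_sqrt h0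
  have h2 := pow_le_pow_left₀ (by positivity) h 2
  rw [hsq, mul_pow _ (√φ ^ (2 * m)), mul_pow (√φ), hsq, ← pow_mul, mul_comm (2 * m) 2, pow_mul, hsq] at h2
  have h3 := mul_le_mul_of_nonneg_right h2 (sq_nonneg (1 - φ))
  have h4 := geom_sum_mul_neg φ (2 * m)
  rw [← h4]
  linarith [h3]

theorem aux_psiM (N M : ℕ) (hM : N = 2 * M) (hM0 : 0 < M) (φ : ℝ) (h0 : 0 < φ) :
    Psi N M φ = (1 - φ) / (1 + φ) := by
  have : (M : ℝ) ≠ 0 := by positivity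
  have e : 2 * Real.pi / (N : ℝ) * M = Real.pi := by
    subst hM; push_cast; field_simp
  unfold Psi
  rw [e, Real.cos_pi]
  rw [div_eq_div_iff (by nlinarith) (by linarith)]
  ring

theorem aux_bounds (N M : ℕ) (hM : N = 2 * M) (hM0 : 0 < M) (hMe : Even M) (φ : ℝ)
    (h0 : 0 < φ) (h1 : φ < 1) (k : ℕ) (hk1 : 1 ≤ k) (hkM : k ≤ M) :
    ((1 - φ) / (1 + φ)) ^ 2 ≤ chi N M k φ ∧ chi N M k φ < 1 := by
  have hMp : (0 : ℝ) < M := by exact_mod_cast hM0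
  have hkp : (1 : ℝ) ≤ k := by exact_mod_cast hk1
  have hkMr : (k : ℝ) ≤ M := by exact_mod_cast hkM
  have hc : 1 ≤ (1 - Real.cos (2 * Real.pi / N * k)) * (M : ℝ) ^ 2 := by
    have e : 2 * Real.pi / (N : ℝ) * k = Real.pi * (k / M) := by
      subst hM; push_cast; field_simp
    have hkd : (k : ℝ) / M ≤ 1 := by rw [div_le_one hMp]; exact hkMr
    have hkd0 : (0 : ℝ) ≤ k / M := by positivity
    have hq := Real.cos_le_one_sub_mul_cos_sq (x := Real.pi * (k / M)) (by
      rw [abs_of_nonneg (by positivity)]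
      nlinarith [Real.pi_pos])
    rw [e]
    have e2 : 2 / Real.pi ^ 2 * (Real.pi * ((k : ℝ) / M)) ^ 2 = 2 * k ^ 2 / M ^ 2 := by
      have := Real.pi_pos.ne'
      field_simp
    rw [e2] at hq
    have h3 : 2 * (k : ℝ) ^ 2 / M ^ 2 * M ^ 2 = 2 * k ^ 2 := by field_simp
    have h4 := mul_le_mul_of_nonneg_right (show 2 * (k : ℝ) ^ 2 / M ^ 2 ≤
      1 - Real.cos (Real.pi * (k / M)) by linarith) (sq_nonneg (M : ℝ))
    nlinarith
  have hcm := Real.neg_one_le_cos (2 * Real.pi / N * k)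
  have hpsi := aux_psiM N M hM hM0 φ h0
  unfold chi
  rw [hpsi]
  unfold Psi PsiBar
  generalize Real.cos (2 * Real.pi / N * k) = c at *
  have hc1 : c < 1 := by
    by_contra hcon
    nlinarith [sq_nonneg (M : ℝ)]
  have hD : 0 < 1 - 2 * φ * c + φ ^ 2 := by nlinarith [sq_nonneg (1 - φ), mul_pos h0 (sub_pos.2 hc1)]
  have hP0 : 0 < φ ^ M := by positivity
  have hP1 : φ ^ M < 1 := pow_lt_one₀ h0.le h1 hM0.ne'
  have hr : 0 < (1 - φ) / (1 + φ) := div_pos (by linarith) (by linarith)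
  have hlow : (1 - φ) / (1 + φ) ≤ (1 - φ ^ 2) / (1 - 2 * φ * c + φ ^ 2) := by
    rw [div_le_div_iff₀ (by linarith) hD]
    nlinarith [mul_nonneg (sub_pos.2 h1).le (mul_nonneg h0.le (by linarith : 0 ≤ 1 + c))]
  have hlow2 : ((1 - φ) / (1 + φ)) ^ 2 ≤
      (1 - φ ^ 2) / (1 - 2 * φ * c + φ ^ 2) * ((1 - φ) / (1 + φ)) := by
    rw [sq]; exact mul_le_mul_of_nonneg_right hlow hr.le
  have hB : 1 ≤ (1 + φ ^ M) / (1 - φ ^ M) := by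
    rw [le_div_iff₀ (by linarith)]; linarith
  have hup : (1 - φ ^ 2) / (1 - 2 * φ * c + φ ^ 2) * ((1 - φ) / (1 + φ))
      * ((1 + φ ^ M) / (1 - φ ^ M)) < 1 := by
    have e : (1 - φ ^ 2) / (1 - 2 * φ * c + φ ^ 2) * ((1 - φ) / (1 + φ))
      * ((1 + φ ^ M) / (1 - φ ^ M)) =
      ((1 - φ) ^ 2 * (1 + φ ^ M)) / ((1 - 2 * φ * c + φ ^ 2) * (1 - φ ^ M)) := by
      have a1 := hD.ne'
      have a2 : 1 + φ ≠ 0 := by linarith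
      have a3 : 1 - φ ^ M ≠ 0 := by linarith
      rw [div_mul_div_comm, div_mul_div_comm,
        div_eq_div_iff (mul_ne_zero (mul_ne_zero a1 a2) a3) (mul_ne_zero a1 a3)]
      ring
    rw [e, div_lt_one (mul_pos hD (by linarith))]
    obtain ⟨m, hm⟩ := hMe
    have hm2 : M = 2 * m := by omega
    have g := aux_geom2 φ h0.le m
    rw [← hm2] at g
    have hcast : (2 * m : ℝ) = M := by rw [hm2]; push_cast; ring
    rw [hcast] at g
    have g2 : φ * (1 - φ ^ M) ^ 2 < φ * (1 - φ ^ M) := by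
      apply mul_lt_mul_of_pos_left _ h0
      nlinarith
    have g3 := mul_le_mul_of_nonneg_left hc (mul_pos h0 (sub_pos.2 hP1)).le
    have key : φ ^ M * (1 - φ) ^ 2 < φ * (1 - φ ^ M) * (1 - c) := by
      have hM2 : (0 : ℝ) < (M : ℝ) ^ 2 := by positivity
      apply lt_of_mul_lt_mul_left _ hM2.le
      linarith
    linarith
  split_ifs with hk
  · refine ⟨hlow2, lt_of_le_of_lt ?_ hup⟩
    exact le_mul_of_one_le_right (le_trans (sq_nonneg _) hlow2) hB
  · exact ⟨hlow2.trans (le_mul_of_one_le_right (le_trans (sq_nonneg _) hlow2) hB), hup⟩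

/-- Class I / Proposition 1(a), spectral form. Let `N` be a multiple of `4`,
`M = N/2`, and let `G` be continuous on `[0,1]` with a unique sign change from
positive to negative at `χ* ∈ (0,1)`. With `φ* = (1−√χ*)/(1+√χ*) ∈ (0,1)`:
for all `φ ∈ (0,φ*)` and all `k = 1,…,M`, `G(χ_k(φ)) < 0` (uniform distribution
stable), and for all `φ ∈ (φ*,1)`, `G(χ_M(φ)) > 0` (unstable in the `N/2`-modal
direction). -/
theorem classI_spectral (N M : ℕ) (hN4 : 4 ∣ N) (hM : M = N / 2) (hN0 : 0 < N)
    (G : ℝ → ℝ) (hG : ContinuousOn G (Set.Icc 0 1))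
    (χs : ℝ) (hχs : χs ∈ Set.Ioo (0 : ℝ) 1)
    (hpos : ∀ χ ∈ Set.Ioo (0 : ℝ) χs, 0 < G χ)
    (hzero : G χs = 0)
    (hneg : ∀ χ ∈ Set.Ioo χs (1 : ℝ), G χ < 0) :
    (1 - Real.sqrt χs) / (1 + Real.sqrt χs) ∈ Set.Ioo (0 : ℝ) 1 ∧
    (∀ φ ∈ Set.Ioo (0 : ℝ) ((1 - Real.sqrt χs) / (1 + Real.sqrt χs)),
      ∀ k, 1 ≤ k → k ≤ M → G (chi N M k φ) < 0) ∧
    (∀ φ ∈ Set.Ioo ((1 - Real.sqrt χs) / (1 + Real.sqrt χs)) (1 : ℝ),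
      0 < G (chi N M M φ)) := by
  have hN2 : N = 2 * M := by omega
  have hM0 : 0 < M := by omega
  have hMe : Even M := by rw [Nat.even_iff]; omega
  obtain ⟨hx0, hx1⟩ := hχs
  have hs0 : 0 < √χs := Real.sqrt_pos.2 hx0
  have hsq : √χs ^ 2 = χs := Real.sq_sqrt hx0.le
  have hs1 : √χs < 1 := by nlinarith
  generalize √χs = s at *
  have hmem : (1 - s) / (1 + s) ∈ Set.Ioo (0 : ℝ) 1 := by
    constructor
    · exact div_pos (by linarith) (by linarith)
    · rw [div_lt_one (by linarith)]; linarith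
  refine ⟨hmem, ?_, ?_⟩
  · rintro φ ⟨h0, h1⟩ k hk1 hkM
    obtain ⟨hl, hu⟩ := aux_bounds N M hN2 hM0 hMe φ h0 (h1.trans hmem.2) k hk1 hkM
    refine hneg _ ⟨lt_of_lt_of_le ?_ hl, hu⟩
    rw [← hsq]
    apply pow_lt_pow_left₀ _ hs0.le two_ne_zero
    rw [lt_div_iff₀ (by linarith)] at h1 ⊢
    linarith
  · rintro φ ⟨h0, h1⟩
    have hφ : 0 < φ := hmem.1.trans h0
    apply hpos
    unfold chi
    rw [if_pos hMe, aux_psiM N M hN2 hM0 φ hφ, ← sq, ← hsq]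
    have hr : 0 < (1 - φ) / (1 + φ) := div_pos (by linarith) (by linarith)
    refine ⟨by positivity, ?_⟩
    apply pow_lt_pow_left₀ _ hr.le two_ne_zero
    rw [div_lt_iff₀ (by linarith)] at h0 ⊢
    linarith
end
end

section
/- (Class II / Proposition 1(b), spectral form.) Let N be a multiple of 4 with M = N/2, and let χ_k(φ) for k = 1,…,M be as defined. Let G : [0,1] → ℝ be continuous, and suppose there exists χ** ∈ (0,1) such that G(χ) < 0 for all χ ∈ (0,χ**), G(χ**) = 0, and G(χ) > 0 for all χ ∈ (χ**,1). Then there exists a unique φ** ∈ (0,1) with χ_1(φ**) = χ**, and: (i) for every φ ∈ (φ**,1) and every k ∈ {1,…,M}, G(χ_k(φ)) < 0 (the uniform distribution is stable); and (ii) for every φ ∈ (0,φ**), G(χ_1(φ)) > 0 (the uniform distribution is unstable in the unimodal direction). -/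
open Real Matrix Finset Set

noncomputable section

lemma aux_hyp (t : ℝ) (ht : 0 ≤ t) (n : ℕ) :
    1 + (n:ℝ)^2 * (cosh t - 1) ≤ cosh (n * t) ∧
    n * sinh t * (1 + ((n:ℝ)^2 - 1) / 3 * (cosh t - 1)) ≤ sinh (n * t) := by
  have hx : 0 ≤ cosh t - 1 := by linarith [one_le_cosh t]
  have hS : 0 ≤ sinh t := sinh_nonneg_iff.2 ht
  have hsq : sinh t ^ 2 = (cosh t - 1) * (cosh t + 1) := by rw [sinh_sq]; ring
  induction n with
  | zero => simp
  | succ n ih =>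
    rcases Nat.eq_zero_or_pos n with rfl | hn
    · simp
    obtain ⟨h1, h2⟩ := ih
    have hn1 : (1:ℝ) ≤ n := by exact_mod_cast hn
    have e : ((n + 1 : ℕ) : ℝ) * t = n * t + t := by push_cast; ring
    rw [e, cosh_add, sinh_add]
    push_cast
    set x := cosh t - 1 with hxd
    have hC : cosh t = x + 1 := by rw [hxd]; ring
    rw [hC] at hsq ⊢
    have hm : 0 ≤ ((n:ℝ)^2 - 1) / 3 := by nlinarith
    constructor
    · have a1 := mul_le_mul_of_nonneg_right h1 (by linarith : 0 ≤ x + 1)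
      have a2 := mul_le_mul_of_nonneg_right h2 hS
      have a3 : (n:ℝ) * sinh t * (1 + ((n:ℝ)^2 - 1) / 3 * x) * sinh t
          = n * (x * (x + 2)) * (1 + ((n:ℝ)^2 - 1) / 3 * x) := by
        linear_combination n * (1 + ((n:ℝ)^2 - 1) / 3 * x) * hsq
      have a4 : n * (x * (x + 2)) * 1 ≤ n * (x * (x + 2)) * (1 + ((n:ℝ)^2 - 1) / 3 * x) := by
        apply mul_le_mul_of_nonneg_left _ (by positivity)
        nlinarith [mul_nonneg hm hx]
      have a5 : 0 ≤ (n:ℝ) * x^2 := by positivity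
      have a6 : 0 ≤ (n:ℝ)^2 * x^2 := by positivity
      nlinarith
    · have a1 := mul_le_mul_of_nonneg_right h2 (by linarith : 0 ≤ x + 1)
      have a2 := mul_le_mul_of_nonneg_right h1 hS
      have a3 : 0 ≤ (n:ℝ) * sinh t * (((n:ℝ)^2 - 1) / 3 * x ^ 2) := by positivity
      nlinarith

lemma aux_key_s8 (M : ℕ) (hM : 2 ≤ M) (e t : ℝ) (he : 2 / (M:ℝ)^2 ≤ e) (ht : 0 < t) :
    M * (cosh t - 1) * (cosh t - 1 + e) < e * sinh t * sinh (M * t) := by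
  have hx : 0 < cosh t - 1 := by linarith [one_lt_cosh.2 ht.ne']
  have hS : 0 < sinh t := sinh_pos_iff.2 ht
  have hsq : sinh t ^ 2 = (cosh t - 1) * (cosh t + 1) := by rw [sinh_sq]; ring
  have h := (aux_hyp t ht.le M).2
  have hM2 : (2:ℝ) ≤ M := by exact_mod_cast hM
  have he0 : 0 < e := lt_of_lt_of_le (by positivity) he
  have he' : 2 ≤ e * (M:ℝ)^2 := by rwa [div_le_iff₀ (by positivity)] at he
  set x := cosh t - 1 with hxd
  have hC : cosh t = x + 1 := by rw [hxd]; ring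
  rw [hC] at hsq
  have a1 := mul_le_mul_of_nonneg_left h (by positivity : 0 ≤ e * sinh t)
  refine lt_of_lt_of_le ?_ a1
  have a3 : e * sinh t * (M * sinh t * (1 + ((M:ℝ)^2 - 1) / 3 * x))
      = M * x * (e * (x + 2) * (1 + ((M:ℝ)^2 - 1) / 3 * x)) := by
    linear_combination e * M * (1 + ((M:ℝ)^2 - 1) / 3 * x) * hsq
  rw [a3]
  apply mul_lt_mul_of_pos_left _ (by positivity)
  have b1 : 0 ≤ e * (((M:ℝ)^2 - 1) / 3 * x^2) := by
    have : 0 ≤ ((M:ℝ)^2 - 1) / 3 := by nlinarith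
    positivity
  have b2 : 0 < e * x := by positivity
  have b3 : 2 * x ≤ e * (M:ℝ)^2 * x := mul_le_mul_of_nonneg_right he' hx.le
  nlinarith

lemma aux_mono (K : ℕ) (hK : 1 ≤ K) (c : ℝ) (he : 2 / ((2 * K : ℕ):ℝ)^2 ≤ 1 - c) :
    StrictMonoOn (fun t : ℝ => (cosh t - 1) * cosh (K * t) / ((cosh t - c) * sinh (K * t)))
      (Set.Ioi 0) := by
  have hK0 : (0:ℝ) < K := by exact_mod_cast hK
  have he0 : 0 < 1 - c := lt_of_lt_of_le (by positivity) he
  have hB : ∀ t : ℝ, 0 < t → 0 < (cosh t - c) * sinh (K * t) := fun t ht =>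
    mul_pos (by linarith [one_le_cosh t]) (sinh_pos_iff.2 (by positivity))
  have hd : ∀ t : ℝ, 0 < t → HasDerivAt
      (fun t : ℝ => (cosh t - 1) * cosh (K * t) / ((cosh t - c) * sinh (K * t)))
      (((sinh t * cosh (K * t) + (cosh t - 1) * (sinh (K * t) * (K * 1))) *
          ((cosh t - c) * sinh (K * t)) -
        ((cosh t - 1) * cosh (K * t)) *
          (sinh t * sinh (K * t) + (cosh t - c) * (cosh (K * t) * (K * 1)))) /
        ((cosh t - c) * sinh (K * t)) ^ 2) t := by
    intro t ht
    have hl : HasDerivAt (fun t : ℝ => (K:ℝ) * t) (K * 1) t := (hasDerivAt_id t).const_mul _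
    exact (((hasDerivAt_cosh t).sub_const 1).mul hl.cosh).div
      (((hasDerivAt_cosh t).sub_const c).mul hl.sinh) (hB t ht).ne'
  apply strictMonoOn_of_deriv_pos (convex_Ioi 0)
  · exact fun t ht => (hd t ht).continuousAt.continuousWithinAt
  · intro t ht
    rw [interior_Ioi] at ht
    rw [(hd t ht).deriv]
    apply div_pos _ (pow_pos (hB t ht) 2)
    have hk := aux_key_s8 (2 * K) (by omega) (1 - c) t he ht
    have e2 : ((2 * K : ℕ):ℝ) * t = 2 * (K * t) := by push_cast; ring
    rw [e2, sinh_two_mul] at hk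
    push_cast at hk
    have h1 := cosh_sq (K * t)
    have : (sinh t * cosh (K * t) + (cosh t - 1) * (sinh (K * t) * (K * 1))) *
          ((cosh t - c) * sinh (K * t)) -
        ((cosh t - 1) * cosh (K * t)) *
          (sinh t * sinh (K * t) + (cosh t - c) * (cosh (K * t) * (K * 1)))
        = (1 - c) * sinh t * (sinh (K * t) * cosh (K * t)) - K * (cosh t - 1) * (cosh t - c) := by
      linear_combination (-(K:ℝ) * (cosh t - 1) * (cosh t - c)) * h1
    rw [this]
    nlinarith

lemma psi_last (K : ℕ) (hK : 1 ≤ K) (φ : ℝ) (h0 : 0 < φ) :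
    Psi (4 * K) (2 * K) φ = (1 - φ) / (1 + φ) := by
  have hK0 : (K:ℝ) ≠ 0 := by positivity
  have : 2 * π / ((4 * K : ℕ) : ℝ) * ((2 * K : ℕ) : ℝ) = π := by
    push_cast; field_simp; ring
  unfold Psi
  rw [this, cos_pi, div_eq_div_iff (by nlinarith) (by linarith)]
  ring

lemma den_pos (c φ : ℝ) (hc : c ≤ 1) (h0 : 0 < φ) (h1 : φ < 1) : 0 < 1 - 2 * φ * c + φ ^ 2 := by
  nlinarith [mul_nonneg h0.le (sub_nonneg.2 hc), mul_pos (sub_pos.2 h1) (sub_pos.2 h1)]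

lemma chi_one_eq (K : ℕ) (hK : 1 ≤ K) (φ : ℝ) (h0 : 0 < φ) (h1 : φ < 1) :
    chi (4 * K) (2 * K) 1 φ = (1 - φ) ^ 2 * (1 + φ ^ (2 * K)) /
      ((1 - 2 * φ * cos (2 * π / (4 * K : ℕ)) + φ ^ 2) * (1 - φ ^ (2 * K))) := by
  have hp : φ ^ (2 * K) < 1 := pow_lt_one₀ h0.le h1 (by omega)
  have hd := den_pos (cos (2 * π / (4 * K : ℕ))) φ (cos_le_one _) h0 h1
  unfold chi
  rw [if_neg (by decide), psi_last K hK φ h0]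
  unfold Psi PsiBar
  rw [Nat.cast_one, mul_one]
  have : 1 - φ ^ (2 * K) ≠ 0 := by linarith
  have h3 : 1 + φ ≠ 0 := by linarith
  have h4 := hd.ne'
  rw [div_mul_div_comm, div_mul_div_comm, div_eq_div_iff (by positivity) (by positivity)]
  ring

lemma chi_one_exp (K : ℕ) (hK : 1 ≤ K) (t : ℝ) (ht : 0 < t) :
    chi (4 * K) (2 * K) 1 (exp (-t)) = (cosh t - 1) * cosh (K * t) /
      ((cosh t - cos (2 * π / (4 * K : ℕ))) * sinh (K * t)) := by
  have hK0 : (0:ℝ) < K := by exact_mod_cast hK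
  rw [chi_one_eq K hK _ (exp_pos _) (by rw [exp_lt_one_iff]; linarith)]
  generalize hc : cos (2 * π / (4 * K : ℕ)) = c
  have hc1 : c ≤ 1 := hc ▸ cos_le_one _
  have e1 : exp (-t) ^ (2 * K) = exp (-(K * t)) ^ 2 := by
    rw [← exp_nat_mul, ← exp_nat_mul]; congr 1; push_cast; ring
  have hC : 1 < cosh t := one_lt_cosh.2 ht.ne'
  have hS : 0 < sinh (K * t) := sinh_pos_iff.2 (by positivity)
  have i1 : exp t * exp (-t) = 1 := by rw [← exp_add]; simp
  have i2 : exp (K * t) * exp (-(K * t)) = 1 := by rw [← exp_add]; simp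
  have f1 : (1 - exp (-t)) ^ 2 = 2 * exp (-t) * (cosh t - 1) := by
    rw [cosh_eq]; linear_combination -i1
  have f2 : 1 - 2 * exp (-t) * c + exp (-t) ^ 2 = 2 * exp (-t) * (cosh t - c) := by
    rw [cosh_eq]; linear_combination -i1
  have f3 : 1 + exp (-(K * t)) ^ 2 = 2 * exp (-(K * t)) * cosh (K * t) := by
    rw [cosh_eq]; linear_combination -i2
  have f4 : 1 - exp (-(K * t)) ^ 2 = 2 * exp (-(K * t)) * sinh (K * t) := by
    rw [sinh_eq]; linear_combination -i2
  rw [e1, f1, f2, f3, f4]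
  have p1 := exp_pos (-t)
  have p2 := exp_pos (-(K * t))
  have p3 : 0 < cosh t - c := by linarith
  rw [div_eq_div_iff (by positivity) (by positivity)]
  ring

lemma chi_one_anti (K : ℕ) (hK : 1 ≤ K) :
    StrictAntiOn (chi (4 * K) (2 * K) 1) (Set.Ioo 0 1) := by
  have hK0 : (1:ℝ) ≤ K := by exact_mod_cast hK
  have he : 2 / ((2 * K : ℕ):ℝ)^2 ≤ 1 - cos (2 * π / (4 * K : ℕ)) := by
    have h := cos_le_one_sub_mul_cos_sq (x := 2 * π / (4 * K : ℕ)) (by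
      rw [abs_of_nonneg (by positivity), div_le_iff₀ (by positivity)]
      push_cast; nlinarith [pi_pos])
    have e : 2 / π ^ 2 * (2 * π / (4 * K : ℕ)) ^ 2 = 2 / ((2 * K : ℕ):ℝ)^2 := by
      push_cast; field_simp; norm_num
    linarith
  intro a ha b hb hab
  have h := aux_mono K hK _ he (a := -log b) (b := -log a)
    (by simpa using log_neg hb.1 hb.2) (by simpa using log_neg ha.1 ha.2)
    (by simpa using log_lt_log ha.1 hab)
  simp only at h
  rw [← chi_one_exp K hK _ (by simpa using log_neg hb.1 hb.2),
    ← chi_one_exp K hK _ (by simpa using log_neg ha.1 ha.2), neg_neg, neg_neg,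
    exp_log ha.1, exp_log hb.1] at h
  exact h

/-- Continuous extension of `χ_1` to `[0,1]`. -/
lemma chi_one_ext (K : ℕ) (hK : 1 ≤ K) : ∃ g : ℝ → ℝ, ContinuousOn g (Set.Icc 0 1) ∧
    g 0 = 1 ∧ g 1 = 0 ∧ ∀ φ ∈ Set.Ioo (0:ℝ) 1, chi (4 * K) (2 * K) 1 φ = g φ := by
  have hK0 : (1:ℝ) ≤ K := by exact_mod_cast hK
  have hc1 : cos (2 * π / (4 * K : ℕ)) < 1 := by
    rw [← cos_zero]
    apply cos_lt_cos_of_nonneg_of_le_pi le_rfl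
    · rw [div_le_iff₀ (by positivity)]
      push_cast; nlinarith [pi_pos]
    · have := pi_pos; positivity
  refine ⟨fun φ => (1 - φ) * (1 + φ ^ (2 * K)) /
      ((1 - 2 * φ * cos (2 * π / (4 * K : ℕ)) + φ ^ 2) * ∑ i ∈ Finset.range (2 * K), φ ^ i),
      ?_, ?_, by simp, ?_⟩
  · apply ContinuousOn.div (by fun_prop) (by fun_prop)
    intro φ hφ
    have h1 : 0 < 1 - 2 * φ * cos (2 * π / (4 * K : ℕ)) + φ ^ 2 := by
      rcases hφ.1.eq_or_lt with h | h
      · rw [← h]; norm_num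
      · nlinarith [mul_pos h (sub_pos.2 hc1), sq_nonneg (1 - φ)]
    have h2 := geom_sum_pos (n := 2 * K) hφ.1 (by omega)
    positivity
  · have : (2 * K) ≠ 0 := by omega
    simp [this, zero_geom_sum]
  · intro φ hφ
    have hp : φ ^ (2 * K) < 1 := pow_lt_one₀ hφ.1.le hφ.2 (by omega)
    rw [chi_one_eq K hK φ hφ.1 hφ.2]
    have hd := den_pos (cos (2 * π / (4 * K : ℕ))) φ (cos_le_one _) hφ.1 hφ.2
    have h2 := geom_sum_pos (n := 2 * K) hφ.1.le (by omega)
    have h3 : 1 - φ ≠ 0 := by linarith [hφ.2]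
    rw [← mul_neg_geom_sum φ (2 * K), div_eq_div_iff (by positivity) (by positivity)]
    ring

lemma chi_bounds (K : ℕ) (hK : 1 ≤ K) (φ : ℝ) (h0 : 0 < φ) (h1 : φ < 1) (k : ℕ) (hk1 : 1 ≤ k)
    (hk : k ≤ 2 * K) :
    0 < chi (4 * K) (2 * K) k φ ∧ chi (4 * K) (2 * K) k φ ≤ chi (4 * K) (2 * K) 1 φ := by
  have hK0 : (1:ℝ) ≤ K := by exact_mod_cast hK
  have hk1' : (1:ℝ) ≤ k := by exact_mod_cast hk1
  have hk' : (k:ℝ) ≤ 2 * K := by exact_mod_cast hk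
  have hp : φ ^ (2 * K) < 1 := pow_lt_one₀ h0.le h1 (by omega)
  have hp0 : 0 < φ ^ (2 * K) := pow_pos h0 _
  have hs : 0 < 1 - φ ^ 2 := by nlinarith
  have hpos : ∀ j, 0 < Psi (4 * K) j φ := fun j =>
    div_pos hs (den_pos _ φ (cos_le_one _) h0 h1)
  have hbar : 1 ≤ PsiBar (2 * K) φ := by
    unfold PsiBar; rw [le_div_iff₀ (by linarith)]; linarith
  have hle : Psi (4 * K) k φ ≤ Psi (4 * K) 1 φ := by
    unfold Psi
    apply div_le_div_of_nonneg_left hs.le (den_pos _ φ (cos_le_one _) h0 h1)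
    have : cos (2 * π / (4 * K : ℕ) * k) ≤ cos (2 * π / (4 * K : ℕ) * (1:ℕ)) := by
      apply cos_le_cos_of_nonneg_of_le_pi
      · have := pi_pos; positivity
      · rw [div_mul_eq_mul_div, div_le_iff₀ (by positivity)]
        push_cast; nlinarith [pi_pos]
      · have := pi_pos
        push_cast
        gcongr
    nlinarith
  have hM := hpos (2 * K)
  have hk0 := hpos k
  have hab : Psi (4 * K) k φ * Psi (4 * K) (2 * K) φ ≤ Psi (4 * K) 1 φ * Psi (4 * K) (2 * K) φ :=
    mul_le_mul_of_nonneg_right hle hM.le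
  have hq := mul_pos hk0 hM
  unfold chi
  rw [if_neg (by decide : ¬ Even 1)]
  split_ifs
  · exact ⟨hq, by nlinarith⟩
  · exact ⟨by positivity, mul_le_mul_of_nonneg_right hab (by linarith)⟩

/-- Class II / Proposition 1(b), spectral form. Let `N` be a multiple of `4`,
`M = N/2`, and let `G` be continuous on `[0,1]` with a unique sign change from
negative to positive at `χ** ∈ (0,1)`. Then there is a unique `φ** ∈ (0,1)` with
`χ_1(φ**) = χ**`, and: for all `φ ∈ (φ**,1)` and all `k = 1,…,M`,
`G(χ_k(φ)) < 0` (uniform distribution stable); for all `φ ∈ (0,φ**)`,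
`G(χ_1(φ)) > 0` (unstable in the unimodal direction). -/
theorem classII_spectral (N M : ℕ) (hN4 : 4 ∣ N) (hM : M = N / 2) (hN0 : 0 < N)
    (G : ℝ → ℝ) (hG : ContinuousOn G (Set.Icc 0 1))
    (χss : ℝ) (hχss : χss ∈ Set.Ioo (0 : ℝ) 1)
    (hneg : ∀ χ ∈ Set.Ioo (0 : ℝ) χss, G χ < 0)
    (hzero : G χss = 0)
    (hpos : ∀ χ ∈ Set.Ioo χss (1 : ℝ), 0 < G χ) :
    ∃ φss ∈ Set.Ioo (0 : ℝ) 1,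
      chi N M 1 φss = χss ∧
      (∀ φ' ∈ Set.Ioo (0 : ℝ) 1, chi N M 1 φ' = χss → φ' = φss) ∧
      (∀ φ ∈ Set.Ioo φss (1 : ℝ), ∀ k, 1 ≤ k → k ≤ M → G (chi N M k φ) < 0) ∧
      (∀ φ ∈ Set.Ioo (0 : ℝ) φss, 0 < G (chi N M 1 φ)) := by
  obtain ⟨K, rfl⟩ := hN4
  obtain rfl : M = 2 * K := by omega
  have hK : 1 ≤ K := by omega
  obtain ⟨g, hgc, hg0, hg1, hgeq⟩ := chi_one_ext K hK
  have hanti := chi_one_anti K hK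
  obtain ⟨p, hp, hgp⟩ := intermediate_value_Icc' zero_le_one hgc
    (show χss ∈ Set.Icc (g 1) (g 0) by rw [hg0, hg1]; exact ⟨hχss.1.le, hχss.2.le⟩)
  have hp0 : p ≠ 0 := by
    rintro rfl; linarith [hχss.2]
  have hp1 : p ≠ 1 := by
    rintro rfl; linarith [hχss.1]
  have hpm : p ∈ Set.Ioo (0:ℝ) 1 := ⟨lt_of_le_of_ne hp.1 hp0.symm, lt_of_le_of_ne hp.2 hp1⟩
  have hlt1 : ∀ φ ∈ Set.Ioo (0:ℝ) 1, chi (4 * K) (2 * K) 1 φ < 1 := by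
    intro φ hφ
    by_contra! hge
    have hh : φ / 2 ∈ Set.Ioo (0:ℝ) 1 := ⟨by linarith [hφ.1], by linarith [hφ.1, hφ.2]⟩
    have h2 := hanti hh hφ (by linarith [hφ.1])
    have h3 := hgeq _ hh
    obtain ⟨y, hy, hgy⟩ := intermediate_value_Icc hh.1.le
      (hgc.mono (Set.Icc_subset_Icc_right hh.2.le))
      (show (1 + g (φ / 2)) / 2 ∈ Set.Icc (g 0) (g (φ / 2)) by
        rw [hg0]; constructor <;> linarith)
    have hy0 : 0 < y := by
      rcases hy.1.eq_or_lt with h | h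
      · rw [← h] at hgy; linarith
      · exact h
    have hym : y ∈ Set.Ioo (0:ℝ) 1 := ⟨hy0, lt_of_le_of_lt hy.2 hh.2⟩
    have h4 := hanti.antitoneOn hym hh hy.2
    have h5 := hgeq _ hym
    linarith
  have hcp : chi (4 * K) (2 * K) 1 p = χss := by rw [hgeq p hpm, hgp]
  refine ⟨p, hpm, hcp, ?_, ?_, ?_⟩
  · intro q hq hqe
    exact hanti.injOn hq hpm (hqe.trans hcp.symm)
  · intro φ hφ k hk1 hk
    have hφm : φ ∈ Set.Ioo (0:ℝ) 1 := ⟨hpm.1.trans hφ.1, hφ.2⟩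
    obtain ⟨b1, b2⟩ := chi_bounds K hK φ hφm.1 hφm.2 k hk1 hk
    have := hanti hpm hφm hφ.1
    exact hneg _ ⟨b1, by linarith⟩
  · intro φ hφ
    have hφm : φ ∈ Set.Ioo (0:ℝ) 1 := ⟨hφ.1, hφ.2.trans hpm.2⟩
    have := hanti hφm hpm hφ.2
    exact hpos _ ⟨by linarith, hlt1 φ hφm⟩
end
end

section
/- (Class III / Proposition 1(c), spectral form.) Let N be a multiple of 4 with M = N/2, and let χ_k(φ) for k = 1,…,M be as defined. Let G : [0,1] → ℝ be continuous, and suppose there exist χ**, χ* ∈ (0,1) with χ** < χ*, G(χ) < 0 for all χ ∈ (0,χ**) ∪ (χ*,1), G(χ**) = G(χ*) = 0, and G(χ) > 0 for all χ ∈ (χ**,χ*). Set φ* := (1−√χ*)/(1+√χ*) and let φ** be the unique solution in (0,1) of χ_1(φ**) = χ**. Then φ* < φ**; for every φ ∈ (0,φ*) ∪ (φ**,1) and every k ∈ {1,…,M}, G(χ_k(φ)) < 0 (the uniform distribution is stable); and there exists ε > 0 such that G(χ_M(φ)) > 0 for all φ ∈ (φ*, φ*+ε) and G(χ_1(φ))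 > 0 for all φ ∈ (φ**−ε, φ**) (so the uniform distribution becomes unstable in the (N/2)-modal direction at φ* and in the unimodal direction at φ**). -/
open Real Matrix Finset Set

noncomputable section

lemma aux_r (r : ℝ) (h0 : 0 ≤ r) (h1 : r ≤ 1) (n : ℕ) :
    ((n:ℝ)+1) * r^n * (1-r^2) ≤ 1 - r^(2*(n+1)) := by
  have hr : 0 ≤ 1 - r^2 := by nlinarith
  induction n using Nat.twoStepInduction with
  | zero => simp
  | one =>
    norm_num
    nlinarith [mul_nonneg hr (sq_nonneg (1-r))]
  | more n ih _ =>
    have e : 1 - r^(2*(n+2+1)) = r^2*(1-r^(2*(n+1))) + (1-r^2)*(1+r^(2*(n+2))) := by ring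
    have h2 : 2 * r^(n+2) ≤ 1 + r^(2*(n+2)) := by
      have : r^(2*(n+2)) = (r^(n+2))^2 := by ring
      rw [this]; nlinarith [sq_nonneg (1 - r^(n+2))]
    have h3 := mul_le_mul_of_nonneg_left ih (sq_nonneg r)
    have h4 := mul_le_mul_of_nonneg_left h2 hr
    rw [e]
    push_cast
    calc ((n:ℝ)+2+1) * r^(n+2) * (1-r^2)
        = r^2 * (((n:ℝ)+1) * r^n * (1-r^2)) + (1-r^2) * (2 * r^(n+2)) := by ring
      _ ≤ _ := add_le_add h3 h4

lemma aux_sq (x : ℝ) (h0 : 0 ≤ x) (h1 : x ≤ 1) (n : ℕ) :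
    ((n:ℝ)+1)^2 * x^n * (1-x)^2 ≤ (1 - x^(n+1))^2 := by
  have h := aux_r (Real.sqrt x) (Real.sqrt_nonneg x) (Real.sqrt_le_one.mpr h1) n
  have hs : Real.sqrt x ^ 2 = x := Real.sq_sqrt h0
  rw [pow_mul, hs] at h
  have h5 : 0 ≤ ((n:ℝ)+1) * Real.sqrt x^n * (1-x) := by
    have := sub_nonneg.mpr h1
    positivity
  have := pow_le_pow_left₀ h5 h 2
  have e : (((n:ℝ)+1) * Real.sqrt x^n * (1-x))^2
      = ((n:ℝ)+1)^2 * x^n * (1-x)^2 := by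
    rw [mul_pow, mul_pow, ← pow_mul, mul_comm n 2, pow_mul, hs]
  rw [e] at this
  exact this

/-- Main polynomial bound, `M = m+1`. -/
lemma aux_Q (x : ℝ) (h0 : 0 ≤ x) (h1 : x ≤ 1) (m : ℕ) :
    x^m * (4*((m:ℝ)+1)*x + (2*((m:ℝ)+1)^3+((m:ℝ)+1))/3*(1-x)^2) * (1-x)
      ≤ (1+x) * (1-x^(2*(m+1))) := by
  have hx : 0 ≤ 1 - x := by linarith
  induction m with
  | zero =>
    norm_num
    nlinarith
  | succ m ih =>
    have ha := aux_sq x h0 h1 m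
    have hb := aux_sq x h0 h1 (m+1)
    push_cast at hb ⊢
    have e : (1+x) * (1-x^(2*(m+1+1))) = x * ((1+x) * (1-x^(2*(m+1)))) +
      (1-x) * (x*((1-x^(m+1))^2 + 2*x^(m+1)) + ((1-x^(m+1+1))^2+2*x^(m+1+1))) := by ring
    rw [e]
    have h3 := mul_le_mul_of_nonneg_left ih h0
    have h4 := mul_le_mul_of_nonneg_left (mul_le_mul_of_nonneg_left ha h0) hx
    have h5 := mul_le_mul_of_nonneg_left hb hx
    refine le_trans (le_of_eq ?_) (le_trans (add_le_add h3 (add_le_add (add_le_add h4 h5)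
      (le_refl ((1-x)*(4*x^(m+2))))) ) (le_of_eq ?_))
    · ring
    · ring

lemma aux_key_s9 (x c : ℝ) (h0 : 0 < x) (h1 : x < 1) (m : ℕ)
    (hc : 2/((m:ℝ)+1)^2 ≤ 1 - c) :
    (1-x)*((1-x)^2+2*x*(1-c))*(((m:ℝ)+1)*x^m) < (1-x^(2*(m+1)))*((1-c)*(1+x)) := by
  have hQ := aux_Q x h0.le h1.le m
  have hx : 0 < 1 - x := by linarith
  have hm : 0 < (m:ℝ)+1 := by positivity
  have hs : 0 < 1 - c := lt_of_lt_of_le (by positivity) hc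
  have h2 := mul_le_mul_of_nonneg_left hQ hs.le
  have hK : (m:ℝ)+1 ≤ (1-c) * ((2*((m:ℝ)+1)^3+((m:ℝ)+1))/3) := by
    have := mul_le_mul_of_nonneg_right hc
      (show 0 ≤ (2*((m:ℝ)+1)^3+((m:ℝ)+1))/3 by positivity)
    refine le_trans ?_ this
    rw [div_mul_eq_mul_div, le_div_iff₀ (by positivity)]
    have : 0 ≤ ((m:ℝ)+1)^3 := by positivity
    nlinarith
  have hp : 0 < x^m := by positivity
  have h3 := mul_le_mul_of_nonneg_left hK (show 0 ≤ x^m * (1-x)^2 * (1-x) by positivity)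
  have h4 : 0 < x^m*(1-x)*((1-c)*(2*((m:ℝ)+1)*x)) := by positivity
  nlinarith

def ff (M : ℕ) (c x : ℝ) : ℝ :=
  ((1-x)^2*(1+x^M)) / ((1-2*x*c+x^2)*(1-x^M))

lemma D_pos (x c : ℝ) (h0 : 0 ≤ x) (hc : c < 1) : 0 < 1-2*x*c+x^2 := by
  rcases h0.eq_or_lt with rfl | h
  · norm_num
  · nlinarith [mul_pos h (sub_pos.mpr hc), sq_nonneg (1-x)]

lemma ff_anti (m : ℕ) (c : ℝ) (hc : 2/((m:ℝ)+1)^2 ≤ 1 - c) :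
    StrictAntiOn (ff (m+1) c) (Set.Ico 0 1) := by
  have hc1 : c < 1 := by
    have : 0 < 2/((m:ℝ)+1)^2 := by positivity
    linarith
  have hne : ∀ x ∈ Set.Ico (0:ℝ) 1, 0 < (1-2*x*c+x^2)*(1-x^(m+1)) := fun x hx =>
    mul_pos (D_pos x c hx.1 hc1) (sub_pos.mpr (pow_lt_one₀ hx.1 hx.2 (by simp)))
  apply strictAntiOn_of_deriv_neg (convex_Ico 0 1)
  · unfold ff
    apply ContinuousOn.div (by fun_prop) (by fun_prop)
    intro x hx
    exact (hne x hx).ne'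
  · intro x hx
    rw [interior_Ico] at hx
    have hd := hne x ⟨hx.1.le, hx.2⟩
    have hk := aux_key_s9 x c hx.1 hx.2 m hc
    have hP := hasDerivAt_pow (m+1) x
    have hi := hasDerivAt_id' x
    have hnum := ((hi.const_sub 1).pow 2).mul (hP.const_add 1)
    have hden := ((((hi.const_mul 2).mul_const c).const_sub 1).add (hi.pow 2)).mul
      (hP.const_sub 1)
    have hf := hnum.div hden hd.ne'
    have hf' := hf.deriv
    have : deriv (ff (m+1) c) x = _ := hf'
    rw [this]
    apply div_neg_of_neg_of_pos
    · have hx1 : 0 < 1 - x := sub_pos.mpr hx.2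
      have := mul_pos hx1 (sub_pos.mpr hk)
      simp
      have e : x^(m+1) = x^m * x := pow_succ x m
      have e2 : x^(2*(m+1)) = (x^m*x)^2 := by ring
      rw [e2] at this
      rw [e]
      nlinarith
    · exact pow_pos hd 2

lemma ff_surj (m : ℕ) (c : ℝ) (hc1 : c < 1) (y : ℝ) (hy : y ∈ Set.Ioo (0:ℝ) 1) :
    ∃ x ∈ Set.Ioo (0:ℝ) 1, ff (m+1) c x = y := by
  let g : ℝ → ℝ := fun x => ((1-x)*(1+x^(m+1))) /
    ((1-2*x*c+x^2)*(∑ i ∈ Finset.range (m+1), x^i))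
  have hS : ∀ x : ℝ, 0 ≤ x → 0 < ∑ i ∈ Finset.range (m+1), x^i := fun x hx =>
    geom_sum_pos hx (by simp)
  have hg : ContinuousOn g (Set.Icc 0 1) := by
    apply ContinuousOn.div (by fun_prop) (by fun_prop)
    intro x hx
    exact (mul_pos (D_pos x c hx.1 hc1) (hS x hx.1)).ne'
  have g0 : g 0 = 1 := by simp [g, Finset.sum_range_succ']
  have g1 : g 1 = 0 := by simp [g]
  have hI := intermediate_value_Ioo' (zero_le_one) hg
  rw [g0, g1] at hI
  obtain ⟨x, hx, hxy⟩ := hI hy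
  refine ⟨x, hx, ?_⟩
  rw [← hxy]
  have h1 : 1 - x ≠ 0 := (sub_pos.mpr hx.2).ne'
  have hD := (D_pos x c hx.1.le hc1).ne'
  have hS' := (hS x hx.1.le).ne'
  have e : 1 - x^(m+1) = (1-x) * ∑ i ∈ Finset.range (m+1), x^i := (mul_neg_geom_sum x _).symm
  simp only [ff, g]
  rw [e]
  field_simp

lemma chi_facts (N m : ℕ) (hN : N = 2*(m+1)) (x : ℝ) (hx : x ∈ Set.Ioo (0:ℝ) 1)
    (hev : Even (m+1)) :
    chi N (m+1) 1 x = ff (m+1) (Real.cos (Real.pi/((m:ℝ)+1))) x ∧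
    chi N (m+1) (m+1) x = ((1-x)/(1+x))^2 ∧
    ∀ k, 1 ≤ k → k ≤ m+1 → chi N (m+1) (m+1) x ≤ chi N (m+1) k x ∧
      chi N (m+1) k x ≤ chi N (m+1) 1 x := by
  obtain ⟨h0, h1⟩ := hx
  have hm : (0:ℝ) < (m:ℝ)+1 := by positivity
  have hang : ∀ k : ℕ, 2*Real.pi/(N:ℝ)*(k:ℝ) = Real.pi/((m:ℝ)+1)*k := by
    intro k; rw [hN]; push_cast; field_simp
  have hx1 : 0 < 1 - x := by linarith
  have hx2 : 0 < 1 + x := by linarith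
  have hx3 : 0 < 1 - x^2 := by nlinarith
  have hpow : 0 < 1 - x^(m+1) := sub_pos.mpr (pow_lt_one₀ h0.le h1 (by simp))
  have hpow0 : 0 < x^(m+1) := by positivity
  have hbar : 1 ≤ PsiBar (m+1) x := by
    unfold PsiBar
    rw [le_div_iff₀ hpow]; linarith
  have hPM : Psi N (m+1) x = (1-x)/(1+x) := by
    unfold Psi
    rw [hang]
    push_cast
    rw [div_mul_cancel₀ _ hm.ne', Real.cos_pi]
    rw [div_eq_div_iff (by nlinarith) hx2.ne']
    ring
  have hPMpos : 0 < Psi N (m+1) x := by rw [hPM]; positivity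
  -- denominators
  have hden : ∀ t : ℝ, 0 < 1 - 2*x*Real.cos t + x^2 := fun t => by
    nlinarith [mul_nonneg h0.le (sub_nonneg.mpr (Real.cos_le_one t)), mul_pos hx1 hx1]
  have hlow : ∀ k : ℕ, Psi N (m+1) x ≤ Psi N k x := by
    intro k
    have hc : Real.cos (2*Real.pi/N*((m+1:ℕ):ℝ)) = -1 := by
      rw [hang]; push_cast; rw [div_mul_cancel₀ _ hm.ne', Real.cos_pi]
    unfold Psi
    apply div_le_div_of_nonneg_left hx3.le (hden _)
    rw [hc]
    nlinarith [mul_nonneg h0.le (neg_le_iff_add_nonneg.mp (Real.neg_one_le_cos (2*Real.pi/N*k)))]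
  have hupp : ∀ k : ℕ, 1 ≤ k → k ≤ m+1 → Psi N k x ≤ Psi N 1 x := by
    intro k hk1 hk2
    unfold Psi
    apply div_le_div_of_nonneg_left hx3.le (hden _)
    have : Real.cos (2*Real.pi/N*(k:ℝ)) ≤ Real.cos (2*Real.pi/N*((1:ℕ):ℝ)) := by
      have hk1' : (1:ℝ) ≤ k := by exact_mod_cast hk1
      have hk2' : (k:ℝ) ≤ (m:ℝ)+1 := by exact_mod_cast hk2
      have hpi := Real.pi_pos
      apply Real.cos_le_cos_of_nonneg_of_le_pi
      · positivity
      · rw [hang, div_mul_eq_mul_div, div_le_iff₀ hm]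
        exact mul_le_mul_of_nonneg_left hk2' hpi.le
      · push_cast
        exact mul_le_mul_of_nonneg_left hk1' (by positivity)
    nlinarith [mul_le_mul_of_nonneg_left this h0.le]
  have c1 : chi N (m+1) 1 x = Psi N 1 x * Psi N (m+1) x * PsiBar (m+1) x := by
    simp [chi]
  have cM : chi N (m+1) (m+1) x = Psi N (m+1) x * Psi N (m+1) x := by
    rw [chi, if_pos hev]
  refine ⟨?_, ?_, ?_⟩
  · rw [c1, hPM]
    have hd := hden (2*Real.pi/N*((1:ℕ):ℝ))
    unfold Psi PsiBar ff
    rw [hang] at hd ⊢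
    simp only [Nat.cast_one, mul_one] at hd ⊢
    have := hd.ne'
    field_simp
    ring
  · rw [cM, hPM]; ring
  · intro k hk1 hk2
    have hl := hlow k
    have hu := hupp k hk1 hk2
    have hkpos : 0 < Psi N k x := lt_of_lt_of_le hPMpos hl
    have hl' := mul_le_mul_of_nonneg_right hl hPMpos.le
    have hu' := mul_le_mul_of_nonneg_right hu hPMpos.le
    have hkp : 0 < Psi N k x * Psi N (m+1) x := mul_pos hkpos hPMpos
    rw [cM, c1]
    unfold chi
    split_ifs
    · exact ⟨hl', hu'.trans (le_mul_of_one_le_right (hkp.le.trans hu') hbar)⟩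
    · exact ⟨hl'.trans (le_mul_of_one_le_right hkp.le hbar),
        mul_le_mul_of_nonneg_right hu' (by linarith)⟩

lemma moeb (x y : ℝ) (hx : x ∈ Set.Ioo (0:ℝ) 1) (hy : y ∈ Set.Ioo (0:ℝ) 1) :
    (x < (1 - Real.sqrt y)/(1+Real.sqrt y) ↔ y < ((1-x)/(1+x))^2) ∧
    ((1 - Real.sqrt y)/(1+Real.sqrt y) < x ↔ ((1-x)/(1+x))^2 < y) := by
  have hs := Real.sqrt_pos.mpr hy.1
  have h1 : 0 < 1 + x := by linarith [hx.1]
  have h2 : 0 < 1 - x := by linarith [hx.2]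
  have h3 : 0 < (1-x)/(1+x) := by positivity
  constructor
  · rw [← Real.sqrt_lt' h3, lt_div_iff₀ (by positivity), lt_div_iff₀ h1]
    constructor <;> intro h <;> nlinarith
  · rw [← Real.lt_sqrt h3.le, div_lt_iff₀ (by positivity), div_lt_iff₀ h1]
    constructor <;> intro h <;> nlinarith

/-- Class III / Proposition 1(c), spectral form. Let `N` be a multiple of `4`,
`M = N/2`, and let `G` be continuous on `[0,1]`, negative on `(0,χ**) ∪ (χ*,1)`,
zero at `χ** < χ*`, and positive on `(χ**,χ*)`. With `φ* = (1−√χ*)/(1+√χ*)` and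
`φ**` the unique solution in `(0,1)` of `χ_1(φ**) = χ**`: `φ* < φ**`; the uniform
distribution is stable for `φ ∈ (0,φ*) ∪ (φ**,1)`; and for some `ε > 0`,
`G(χ_M(φ)) > 0` on `(φ*,φ*+ε)` and `G(χ_1(φ)) > 0` on `(φ**−ε,φ**)`. -/
theorem classIII_spectral (N M : ℕ) (hN4 : 4 ∣ N) (hM : M = N / 2) (hN0 : 0 < N)
    (G : ℝ → ℝ) (hG : ContinuousOn G (Set.Icc 0 1))
    (χss χs : ℝ) (hχss : χss ∈ Set.Ioo (0 : ℝ) 1) (hχs : χs ∈ Set.Ioo (0 : ℝ) 1)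
    (hlt : χss < χs)
    (hneg : ∀ χ ∈ Set.Ioo (0 : ℝ) χss ∪ Set.Ioo χs (1 : ℝ), G χ < 0)
    (hzero1 : G χss = 0) (hzero2 : G χs = 0)
    (hpos : ∀ χ ∈ Set.Ioo χss χs, 0 < G χ) :
    ∃ φss ∈ Set.Ioo (0 : ℝ) 1,
      chi N M 1 φss = χss ∧
      (∀ φ' ∈ Set.Ioo (0 : ℝ) 1, chi N M 1 φ' = χss → φ' = φss) ∧
      (1 - Real.sqrt χs) / (1 + Real.sqrt χs) < φss ∧
      (∀ φ ∈ Set.Ioo (0 : ℝ) ((1 - Real.sqrt χs) / (1 + Real.sqrt χs)) ∪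
          Set.Ioo φss (1 : ℝ),
        ∀ k, 1 ≤ k → k ≤ M → G (chi N M k φ) < 0) ∧
      ∃ ε > (0 : ℝ),
        (∀ φ ∈ Set.Ioo ((1 - Real.sqrt χs) / (1 + Real.sqrt χs))
            ((1 - Real.sqrt χs) / (1 + Real.sqrt χs) + ε), 0 < G (chi N M M φ)) ∧
        (∀ φ ∈ Set.Ioo (φss - ε) φss, 0 < G (chi N M 1 φ)) := by
  obtain ⟨m, rfl⟩ : ∃ m, M = m+1 := ⟨M-1, by omega⟩
  have hN : N = 2*(m+1) := by omega
  have hev : Even (m+1) := by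
    obtain ⟨q, rfl⟩ := hN4
    exact ⟨q, by omega⟩
  have hc : 2/((m:ℝ)+1)^2 ≤ 1 - Real.cos (Real.pi/((m:ℝ)+1)) := by
    have hm : (0:ℝ) < (m:ℝ)+1 := by positivity
    have hpi := Real.pi_pos
    have := Real.cos_le_one_sub_mul_cos_sq (x := Real.pi/((m:ℝ)+1)) (by
      rw [abs_of_pos (by positivity)]
      exact div_le_self hpi.le (by linarith [(Nat.cast_nonneg m : (0:ℝ) ≤ m)]))
    have e : 2/Real.pi^2*(Real.pi/((m:ℝ)+1))^2 = 2/((m:ℝ)+1)^2 := by field_simp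
    rw [e] at this
    linarith
  have hc1 : Real.cos (Real.pi/((m:ℝ)+1)) < 1 := by
    have : 0 < 2/((m:ℝ)+1)^2 := by positivity
    linarith
  have hF := fun x hx => chi_facts N m hN x hx hev
  generalize Real.cos (Real.pi/((m:ℝ)+1)) = c at hc hc1 hF
  have hanti := ff_anti m c hc
  have hIco : ∀ {x : ℝ}, x ∈ Set.Ioo (0:ℝ) 1 → x ∈ Set.Ico (0:ℝ) 1 := fun h => ⟨h.1.le, h.2⟩
  obtain ⟨p, hp, hpe⟩ := ff_surj m c hc1 χss hχss
  obtain ⟨q, hq, hqe⟩ := ff_surj m c hc1 χs hχs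
  have hstar : ∀ y ∈ Set.Ioo (0:ℝ) 1,
      (1 - Real.sqrt y)/(1+Real.sqrt y) ∈ Set.Ioo (0:ℝ) 1 := by
    intro y hy
    have hs := Real.sqrt_pos.mpr hy.1
    have hs1 : Real.sqrt y < 1 := (Real.sqrt_lt' one_pos).mpr (by linarith [hy.2])
    exact ⟨div_pos (by linarith) (by linarith), by rw [div_lt_one (by linarith)]; linarith⟩
  have hs1 := hstar χs hχs
  have hs2 := hstar χss hχss
  have hss : (1 - Real.sqrt χs)/(1+Real.sqrt χs) < (1 - Real.sqrt χss)/(1+Real.sqrt χss) := by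
    have e : ((1-(1 - Real.sqrt χs)/(1+Real.sqrt χs))/(1+(1 - Real.sqrt χs)/(1+Real.sqrt χs)))^2
        = χs := by
      have := moeb _ χs hs1 hχs
      exact le_antisymm (not_lt.mp fun h => lt_irrefl _ (this.1.2 h))
        (not_lt.mp fun h => lt_irrefl _ (this.2.2 h))
    exact (moeb _ χss hs1 hχss).1.2 (by rw [e]; exact hlt)
  have hqp : q < p := by
    rw [← hanti.lt_iff_gt (hIco hp) (hIco hq), hpe, hqe]; exact hlt
  have hsq : (1 - Real.sqrt χs)/(1+Real.sqrt χs) ≤ q := by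
    rw [← not_lt]
    intro h
    have h1 := (moeb q χs hq hχs).1.1 h
    have hf := hF q hq
    have h2 := (hf.2.2 1 le_rfl (by omega)).1
    rw [hf.1, hf.2.1, hqe] at h2
    linarith
  have hff0 : ff (m+1) c 0 = 1 := by simp [ff]
  refine ⟨p, hp, by rw [(hF p hp).1, hpe], ?_, hsq.trans_lt hqp, ?_, ?_⟩
  · intro x hx h
    rw [(hF x hx).1, ← hpe] at h
    exact hanti.injOn (hIco hx) (hIco hp) h
  · rintro x (hx | hx) k hk1 hk2
    · have hx' : x ∈ Set.Ioo (0:ℝ) 1 := ⟨hx.1, hx.2.trans hs1.2⟩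
      have hf := hF x hx'
      have hb := hf.2.2 k hk1 hk2
      rw [hf.1, hf.2.1] at hb
      have h1 := (moeb x χs hx' hχs).1.1 hx.2
      have h2 := hanti ⟨le_rfl, one_pos⟩ (hIco hx') hx.1
      rw [hff0] at h2
      exact hneg _ (Or.inr ⟨h1.trans_le hb.1, hb.2.trans_lt h2⟩)
    · have hx' : x ∈ Set.Ioo (0:ℝ) 1 := ⟨hp.1.trans hx.1, hx.2⟩
      have hf := hF x hx'
      have hb := hf.2.2 k hk1 hk2
      rw [hf.1, hf.2.1] at hb
      have h2 := hanti (hIco hp) (hIco hx') hx.1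
      rw [hpe] at h2
      have h3 : 0 < ((1-x)/(1+x))^2 :=
        pow_pos (div_pos (by linarith [hx'.2]) (by linarith [hx'.1])) 2
      exact hneg _ (Or.inl ⟨h3.trans_le hb.1, hb.2.trans_lt h2⟩)
  · refine ⟨min ((1 - Real.sqrt χss)/(1+Real.sqrt χss) - (1 - Real.sqrt χs)/(1+Real.sqrt χs))
      (p - q), lt_min (sub_pos.mpr hss) (sub_pos.mpr hqp), ?_, ?_⟩
    · intro x hx
      have hxl : x < (1 - Real.sqrt χss)/(1+Real.sqrt χss) := by
        have := min_le_left ((1 - Real.sqrt χss)/(1+Real.sqrt χss)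
          - (1 - Real.sqrt χs)/(1+Real.sqrt χs)) (p - q)
        linarith [hx.2]
      have hx' : x ∈ Set.Ioo (0:ℝ) 1 := ⟨hs1.1.trans hx.1, hxl.trans hs2.2⟩
      rw [(hF x hx').2.1]
      exact hpos _ ⟨(moeb x χss hx' hχss).1.1 hxl, (moeb x χs hx' hχs).2.1 hx.1⟩
    · intro x hx
      have hxq : q < x := by
        have := min_le_right ((1 - Real.sqrt χss)/(1+Real.sqrt χss)
          - (1 - Real.sqrt χs)/(1+Real.sqrt χs)) (p - q)
        linarith [hx.1]
      have hx' : x ∈ Set.Ioo (0:ℝ) 1 := ⟨hq.1.trans hxq, hx.2.trans hp.2⟩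
      have h1 := hanti (hIco hx') (hIco hp) hx.2
      have h2 := hanti (hIco hq) (hIco hx') hxq
      rw [hpe] at h1
      rw [hqe] at h2
      rw [(hF x hx').1]
      exact hpos _ ⟨h1, h2⟩
end
end

section
/- (Positive-correlation second-order inequality.) Let U ⊆ ℝ^N be an open neighborhood of x̄, and let v, f : U → ℝ^N be differentiable at x̄ with f(x̄) = 0, v(x̄) = v̄·𝟙 for some v̄ ∈ ℝ (where 𝟙 is the all-ones vector), Σ_{i=1}^{N} f_i(x) = 0 for all x ∈ U, and ⟨v(x), f(x)⟩ ≥ 0 for all x ∈ U. Then for every z ∈ ℝ^N, ⟨Dv(x̄)z, Df(x̄)z⟩ ≥ 0, where Dv(x̄) and Df(x̄) denote the Jacobian matrices of v and f at x̄. In particular, if z is a common eigenvector of Dv(x̄) and Df(x̄) with respective eigenvalues ω and η, then ωη ≥ 0. -/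
open Real Finset

noncomputable section

/-- Positive-correlation second-order inequality. Let `U` be an open neighborhood
of `x̄`, and `v, f : U → ℝ^N` differentiable at `x̄` with `f(x̄) = 0`,
`v(x̄) = v̄ 𝟙`, `Σ_i f_i ≡ 0` on `U`, and `⟨v(x), f(x)⟩ ≥ 0` on `U`. Then for all
`z`, `⟨Dv(x̄)z, Df(x̄)z⟩ ≥ 0`; in particular if `z ≠ 0` is a common eigenvector of
the Jacobians with eigenvalues `ω` and `η`, then `ωη ≥ 0`. -/
theorem positive_correlation_second_order (N : ℕ)
    (U : Set (Fin N → ℝ)) (hU : IsOpen U)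
    (xbar : Fin N → ℝ) (hxbar : xbar ∈ U)
    (v f : (Fin N → ℝ) → (Fin N → ℝ))
    (Dv Df : (Fin N → ℝ) →L[ℝ] (Fin N → ℝ))
    (hv : HasFDerivAt v Dv xbar) (hf : HasFDerivAt f Df xbar)
    (hf0 : f xbar = 0)
    (vbar : ℝ) (hvbar : v xbar = fun _ => vbar)
    (hmass : ∀ x ∈ U, ∑ i, f x i = 0)
    (hpc : ∀ x ∈ U, 0 ≤ ∑ i, v x i * f x i) :
    (∀ z : Fin N → ℝ, 0 ≤ ∑ i, Dv z i * Df z i) ∧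
    (∀ z : Fin N → ℝ, z ≠ 0 → ∀ ω η : ℝ,
      Dv z = ω • z → Df z = η • z → 0 ≤ ω * η) := by
  have key : ∀ z : Fin N → ℝ, 0 ≤ ∑ i, Dv z i * Df z i := by
    intro z
    have h1 := (hv.hasLineDerivAt z).tendsto_slope_zero
    have h2 := (hf.hasLineDerivAt z).tendsto_slope_zero
    rw [tendsto_pi_nhds] at h1 h2
    have h3 := tendsto_finsetSum Finset.univ (fun i _ => (h1 i).mul (h2 i))
    refine ge_of_tendsto h3 ?_
    have hc : Continuous (fun t : ℝ => xbar + t • z) := by fun_prop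
    have hU' : ∀ᶠ t in nhds (0 : ℝ), xbar + t • z ∈ U :=
      hc.continuousAt.eventually_mem (hU.mem_nhds (by simpa using hxbar))
    filter_upwards [hU'.filter_mono nhdsWithin_le_nhds] with t ht
    have hm := hmass _ ht
    have hp := hpc _ ht
    have e : ∑ i, (t⁻¹ • (v (xbar + t • z) - v xbar)) i * (t⁻¹ • (f (xbar + t • z) - f xbar)) i
        = (t⁻¹) ^ 2 * (∑ i, v (xbar + t • z) i * f (xbar + t • z) i
            - vbar * ∑ i, f (xbar + t • z) i) := by
      rw [Finset.mul_sum, ← Finset.sum_sub_distrib, Finset.mul_sum]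
      refine Finset.sum_congr rfl fun i _ => ?_
      simp only [Pi.smul_apply, Pi.sub_apply, smul_eq_mul, hf0, hvbar, Pi.zero_apply]
      ring
    rw [e, hm]
    have := sq_nonneg (t⁻¹)
    simpa using mul_nonneg this hp
  refine ⟨key, fun z hz ω η h1 h2 => ?_⟩
  have h := key z
  have e : ∑ i, Dv z i * Df z i = (ω * η) * ∑ i, z i ^ 2 := by
    rw [h1, h2, Finset.mul_sum]
    refine Finset.sum_congr rfl fun i _ => ?_
    simp only [Pi.smul_apply, smul_eq_mul]
    ring
  rw [e] at h
  obtain ⟨i, hi⟩ := Function.ne_iff.mp hz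
  have hpos : 0 < ∑ i, z i ^ 2 :=
    Finset.sum_pos' (fun i _ => sq_nonneg _) ⟨i, Finset.mem_univ i, by
      have : z i ≠ 0 := hi
      positivity⟩
  exact nonneg_of_mul_nonneg_left h hpos
end
end

section
/- (Proposition 2, spectral form.) Let N = 2M with M ≥ 1 and let χ_k(φ) for k = 1,…,M be as defined. Let δ : (0,1) → ℝ be differentiable, let c_1,…,c_M ≥ 0 with c_k > 0 for at least one k, and define ρ(φ) := Σ_{k=1}^{M} c_k δ(χ_k(φ)) for φ ∈ (0,1). (a) If δ′(χ) < 0 for all χ ∈ (0,1), then ρ is strictly increasing on (0,1). (b) If δ′(χ) > 0 for all χ ∈ (0,1), then ρ is strictly decreasing on (0,1). -/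
open Real Finset Set

noncomputable section

lemma aux_sinh_ge (s : ℝ) (hs : 0 < s) (m : ℕ) : m * Real.sinh s ≤ Real.sinh (m * s) := by
  induction m with
  | zero => simp
  | succ n ih =>
    have e : ((n + 1 : ℕ) : ℝ) * s = n * s + s := by push_cast; ring
    rw [e, Real.sinh_add]
    have h1 : 0 < Real.sinh s := Real.sinh_pos_iff.2 hs
    have h2 := Real.one_le_cosh s
    have h3 := Real.one_le_cosh (n * s)
    have h4 : 0 ≤ Real.sinh (n * s) := Real.sinh_nonneg_iff.2 (by positivity)
    push_cast
    nlinarith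

lemma aux_sinh_two (s : ℝ) (hs : 0 < s) (m : ℕ) :
    2 * Real.sinh s * Real.cosh s * (m + 2 / 3 * ((m : ℝ) ^ 3 - m) * Real.sinh s ^ 2)
      ≤ Real.sinh (2 * (m * s)) := by
  induction m with
  | zero => simp
  | succ n ih =>
    have e : 2 * (((n + 1 : ℕ) : ℝ) * s) = 2 * (n * s) + 2 * s := by push_cast; ring
    rw [e, Real.sinh_add, Real.sinh_two_mul s]
    have h1 : 0 < Real.sinh s := Real.sinh_pos_iff.2 hs
    have h2 : 0 < Real.cosh s := Real.cosh_pos s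
    have hc : Real.cosh (2 * s) = 1 + 2 * Real.sinh s ^ 2 := by
      rw [Real.cosh_two_mul, Real.cosh_sq]; ring
    have hc2 : 1 + 2 * (n * Real.sinh s) ^ 2 ≤ Real.cosh (2 * (n * s)) := by
      rw [Real.cosh_two_mul, Real.cosh_sq]
      have := pow_le_pow_left₀ (by positivity) (aux_sinh_ge s hs n) 2
      linarith
    have hn : (0 : ℝ) ≤ (n : ℝ) ^ 3 - n := by
      rcases Nat.eq_zero_or_pos n with h | h
      · simp [h]
      · have : (1 : ℝ) ≤ n := by exact_mod_cast h
        have : (n : ℝ) ^ 3 - n = n * (n - 1) * (n + 1) := by ring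
        rw [this]
        have : (0 : ℝ) ≤ n - 1 := by linarith
        positivity
    rw [hc]
    set x := Real.sinh s
    set y := Real.cosh s
    have a1 := mul_le_mul_of_nonneg_right ih (by positivity : 0 ≤ 1 + 2 * x ^ 2)
    have a2 := mul_le_mul_of_nonneg_right hc2 (by positivity : 0 ≤ 2 * x * y)
    have a3 : 0 ≤ 2 * x * y * (2 / 3 * ((n : ℝ) ^ 3 - n) * x ^ 2) * (2 * x ^ 2) := by positivity
    push_cast
    nlinarith

lemma aux_key_s12 (s : ℝ) (hs : 0 < s) (m : ℕ) (hm : 1 ≤ m) (σ : ℝ) (hσ : 1 / (m : ℝ) ^ 2 ≤ σ) :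
    m * Real.sinh s * (Real.sinh s ^ 2 + σ) < Real.cosh s * σ * Real.sinh (2 * (m * s)) := by
  have hm' : (1 : ℝ) ≤ m := by exact_mod_cast hm
  have h1 : 0 < Real.sinh s := Real.sinh_pos_iff.2 hs
  have h2 : 0 < Real.cosh s := Real.cosh_pos s
  have h := aux_sinh_two s hs m
  have hσ0 : 0 < σ := lt_of_lt_of_le (by positivity) hσ
  have hσ1 : 1 ≤ σ * (m : ℝ) ^ 2 := by
    rwa [div_le_iff₀ (by positivity)] at hσ
  refine lt_of_lt_of_le ?_ (mul_le_mul_of_nonneg_left h (by positivity))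
  have hc := Real.cosh_sq s
  set x := Real.sinh s
  set y := Real.cosh s
  have e : y * σ * (2 * x * y * (m + 2 / 3 * ((m : ℝ) ^ 3 - m) * x ^ 2))
      = σ * 2 * x * ((x ^ 2 + 1) * (m + 2 / 3 * ((m : ℝ) ^ 3 - m) * x ^ 2)) := by
    rw [← hc]; ring
  rw [e]
  have hn : (0 : ℝ) ≤ (m : ℝ) ^ 3 - m := by
    have : (m : ℝ) ^ 3 - m = m * (m - 1) * (m + 1) := by ring
    rw [this]
    have : (0 : ℝ) ≤ m - 1 := by linarith
    positivity
  have k1 : (m : ℝ) * (x ^ 2 + σ) ≤ σ * (m ^ 3 * x ^ 2 + m) := by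
    have : 0 ≤ (m : ℝ) * x ^ 2 * (σ * m ^ 2 - 1) :=
      mul_nonneg (by positivity) (by linarith)
    nlinarith
  have k2 : (m : ℝ) ^ 3 * x ^ 2 + m
      < 2 * ((x ^ 2 + 1) * (m + 2 / 3 * ((m : ℝ) ^ 3 - m) * x ^ 2)) := by
    have b1 : 0 ≤ ((m : ℝ) ^ 3 - m) * x ^ 2 * x ^ 2 := by positivity
    have b2 : 0 ≤ (m : ℝ) ^ 3 * x ^ 2 := by positivity
    have b3 : 0 ≤ (m : ℝ) * x ^ 2 := by positivity
    nlinarith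
  have k3 := mul_lt_mul_of_pos_left k2 hσ0
  have := mul_lt_mul_of_pos_left (lt_of_le_of_lt k1 k3) h1
  nlinarith

/-- The odd eigenvalue in hyperbolic coordinates. -/
def auxF (m : ℕ) (σ s : ℝ) : ℝ :=
  (Real.cosh (m * s) * Real.sinh s ^ 2) / ((Real.sinh s ^ 2 + σ) * Real.sinh (m * s))

lemma auxF_mono (m : ℕ) (hm : 1 ≤ m) (σ : ℝ) (hσ : 1 / (m : ℝ) ^ 2 ≤ σ) :
    StrictMonoOn (auxF m σ) (Set.Ioi 0) := by
  have hm' : (1 : ℝ) ≤ m := by exact_mod_cast hm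
  have hσ0 : 0 < σ := lt_of_lt_of_le (by positivity) hσ
  have key : ∀ s ∈ Set.Ioi (0 : ℝ), ∃ d, 0 < d ∧ HasDerivAt (auxF m σ) d s := by
    intro s hs
    have hs : 0 < s := hs
    have h1 : 0 < Real.sinh s := Real.sinh_pos_iff.2 hs
    have h3 : 0 < Real.sinh (m * s) := Real.sinh_pos_iff.2 (by positivity)
    have hl : HasDerivAt (fun s : ℝ => (m : ℝ) * s) m s := by
      simpa using (hasDerivAt_id s).const_mul (m : ℝ)
    have d1 := ((Real.hasDerivAt_cosh (m * s)).comp s hl).mul ((Real.hasDerivAt_sinh s).pow 2)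
    have d2 := (((Real.hasDerivAt_sinh s).pow 2).add_const σ).mul
      ((Real.hasDerivAt_sinh (m * s)).comp s hl)
    have d := d1.div d2 (by
      show (Real.sinh s ^ 2 + σ) * Real.sinh (m * s) ≠ 0
      positivity)
    refine ⟨_, ?_, d⟩
    simp
    apply div_pos
    · have k := mul_pos h1 (sub_pos.2 (aux_key_s12 s hs m hm σ hσ))
      rw [Real.sinh_two_mul] at k
      have hc := Real.cosh_sq (m * s)
      have : ∀ A B S C : ℝ, B ^ 2 = A ^ 2 + 1 →
          0 < S * (C * σ * (2 * A * B) - m * S * (S ^ 2 + σ)) →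
          0 < (A * m * S ^ 2 + B * (2 * S * C)) * ((S ^ 2 + σ) * A)
            - B * S ^ 2 * (2 * S * C * A + (S ^ 2 + σ) * (B * m)) := by
        intro A B S C h k
        have : (A * m * S ^ 2 + B * (2 * S * C)) * ((S ^ 2 + σ) * A)
            - B * S ^ 2 * (2 * S * C * A + (S ^ 2 + σ) * (B * m))
            = S * (C * σ * (2 * A * B) - m * S * (S ^ 2 + σ)) := by
          linear_combination (-m * S ^ 2 * (S ^ 2 + σ)) * h
        rw [this]; exact k
      exact this _ _ _ _ hc k
    · positivity
  apply strictMonoOn_of_deriv_pos (convex_Ioi 0)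
  · intro s hs
    obtain ⟨d, -, h⟩ := key s hs
    exact h.continuousAt.continuousWithinAt
  · intro s hs
    rw [interior_Ioi] at hs
    obtain ⟨d, hd, h⟩ := key s hs
    rw [h.deriv]; exact hd

lemma auxF_eq (m : ℕ) (hm : 1 ≤ m) (σ : ℝ) (hσ : 0 < σ) (φ : ℝ) (h0 : 0 < φ) (h1 : φ < 1) :
    (1 - φ) ^ 2 / ((1 - φ) ^ 2 + 4 * φ * σ) * ((1 + φ ^ m) / (1 - φ ^ m))
      = auxF m σ (-Real.log φ / 2) := by
  set s := -Real.log φ / 2 with hs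
  have hs0 : 0 < s := by have := Real.log_neg h0 h1; linarith
  have hφ : φ = Real.exp (-s) ^ 2 := by
    rw [← Real.exp_nat_mul, hs]
    push_cast
    rw [show (2 : ℝ) * -(-Real.log φ / 2) = Real.log φ by ring, Real.exp_log h0]
  have hm0 : (m : ℝ) ≠ 0 := by positivity
  have e1 : Real.sinh s = (1 - φ) / (2 * Real.exp (-s)) := by
    rw [Real.sinh_eq, hφ, Real.exp_neg]; field_simp
  have em : Real.exp (-(m * s)) ^ 2 = φ ^ m := by
    rw [hφ, ← Real.exp_nat_mul, ← Real.exp_nat_mul, ← Real.exp_nat_mul]; congr 1; ring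
  have e2 : Real.sinh (m * s) = (1 - φ ^ m) / (2 * Real.exp (-(m * s))) := by
    rw [← em, Real.sinh_eq, Real.exp_neg]; field_simp
  have e3 : Real.cosh (m * s) = (1 + φ ^ m) / (2 * Real.exp (-(m * s))) := by
    rw [← em, Real.cosh_eq, Real.exp_neg]; field_simp
  have e4 : Real.sinh s ^ 2 = (1 - φ) ^ 2 / (4 * φ) := by
    rw [e1, div_pow, mul_pow, ← hφ]; norm_num
  rw [auxF, e4, e2, e3]
  have p1 : φ ^ m < 1 := pow_lt_one₀ h0.le h1 (by omega)
  have p2 : 1 - φ ^ m ≠ 0 := by linarith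
  have p3 : (1 - φ) ^ 2 + 4 * φ * σ ≠ 0 := by positivity
  have p4 := Real.exp_pos (-(m * s))
  have p5 : (1 - φ) ^ 2 / (4 * φ) + σ ≠ 0 := by positivity
  have p6 : (1 - φ) ^ 2 / (4 * φ) + σ = ((1 - φ) ^ 2 + 4 * φ * σ) / (4 * φ) := by field_simp
  rw [p6]
  field_simp

lemma aux_even (σ : ℝ) (hσ : 0 < σ) :
    StrictAntiOn (fun φ : ℝ => (1 - φ) ^ 2 / ((1 - φ) ^ 2 + 4 * φ * σ)) (Set.Ioo 0 1) := by
  intro a ha b hb hab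
  obtain ⟨a0, a1⟩ := ha
  obtain ⟨b0, b1⟩ := hb
  show (1 - b) ^ 2 / ((1 - b) ^ 2 + 4 * b * σ) < (1 - a) ^ 2 / ((1 - a) ^ 2 + 4 * a * σ)
  rw [div_lt_div_iff₀ (by positivity) (by positivity)]
  have : 0 < 4 * σ * ((b - a) * (1 - a * b)) := by
    have : a * b < 1 := by nlinarith
    have := mul_pos (sub_pos.2 hab) (sub_pos.2 this)
    positivity
  nlinarith

lemma aux_odd (m : ℕ) (hm : 1 ≤ m) (σ : ℝ) (hσ : 1 / (m : ℝ) ^ 2 ≤ σ) :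
    StrictAntiOn (fun φ : ℝ => (1 - φ) ^ 2 / ((1 - φ) ^ 2 + 4 * φ * σ) *
      ((1 + φ ^ m) / (1 - φ ^ m))) (Set.Ioo 0 1) := by
  have hm' : (1 : ℝ) ≤ m := by exact_mod_cast hm
  have hσ0 : 0 < σ := lt_of_lt_of_le (by positivity) hσ
  intro a ha b hb hab
  show _ * _ < _ * _
  rw [auxF_eq m hm σ hσ0 a ha.1 ha.2, auxF_eq m hm σ hσ0 b hb.1 hb.2]
  have l1 := Real.log_neg ha.1 ha.2
  have l2 := Real.log_neg hb.1 hb.2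
  have l3 := Real.log_lt_log ha.1 hab
  apply auxF_mono m hm σ hσ
  · rw [Set.mem_Ioi]
    linarith
  · rw [Set.mem_Ioi]
    linarith
  · linarith

lemma aux_lt_one (f : ℝ → ℝ) (hf : StrictAntiOn f (Set.Ioo 0 1)) (h0 : f 0 = 1)
    (hc : ContinuousAt f 0) : ∀ φ ∈ Set.Ioo (0 : ℝ) 1, f φ < 1 := by
  intro φ hφ
  obtain ⟨a, b⟩ := hφ
  have h1 : f φ < f (φ / 2) := hf ⟨by linarith, by linarith⟩ ⟨a, b⟩ (by linarith)
  refine lt_of_lt_of_le h1 ?_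
  rw [← h0]
  have ht : Filter.Tendsto f (nhdsWithin 0 (Set.Ioi 0)) (nhds (f 0)) :=
    hc.tendsto.mono_left nhdsWithin_le_nhds
  refine ge_of_tendsto ht ?_
  filter_upwards [Ioo_mem_nhdsGT (show (0 : ℝ) < φ / 2 by linarith)] with x hx
  exact (hf ⟨hx.1, by linarith [hx.2]⟩ ⟨by linarith, by linarith⟩ hx.2).le

lemma aux_psi (M k : ℕ) (hM : 1 ≤ M) (φ : ℝ) (hφ : φ ∈ Set.Ioo (0 : ℝ) 1) :
    Psi (2 * M) k φ * Psi (2 * M) M φ = (1 - φ) ^ 2 /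
      ((1 - φ) ^ 2 + 4 * φ * Real.sin (Real.pi / 2 * (k / M)) ^ 2) := by
  obtain ⟨h0, h1⟩ := hφ
  have hm : (M : ℝ) ≠ 0 := by positivity
  have e1 : 2 * Real.pi / ((2 * M : ℕ) : ℝ) * M = Real.pi := by push_cast; field_simp
  have e2 : 2 * Real.pi / ((2 * M : ℕ) : ℝ) * k = 2 * (Real.pi / 2 * (k / M)) := by
    push_cast; field_simp
  rw [Psi, Psi, e1, e2, Real.cos_pi, Real.cos_two_mul, Real.cos_sq']
  set σ := Real.sin (Real.pi / 2 * (k / M)) ^ 2 with hσ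
  have hσ0 : 0 ≤ σ := by positivity
  have : 0 < (1 - φ) ^ 2 := by have := sub_pos.2 h1; positivity
  have p1 : (1 - φ) ^ 2 + 4 * φ * σ ≠ 0 := by positivity
  have p2 : 1 - 2 * φ * (2 * (1 - σ) - 1) + φ ^ 2 = (1 - φ) ^ 2 + 4 * φ * σ := by ring
  have p3 : 1 - 2 * φ * -1 + φ ^ 2 = (1 + φ) ^ 2 := by ring
  rw [p2, p3]
  have p4 : 1 + φ ≠ 0 := by positivity
  field_simp
  ring

lemma aux_sin (M k : ℕ) (hk : k ∈ Finset.Icc 1 M) :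
    1 / (M : ℝ) ^ 2 ≤ Real.sin (Real.pi / 2 * (k / M)) ^ 2 := by
  obtain ⟨h1, h2⟩ := Finset.mem_Icc.1 hk
  have hM : (0 : ℝ) < M := by exact_mod_cast (by omega : 0 < M)
  have hk1 : (1 : ℝ) ≤ k := by exact_mod_cast h1
  have hk2 : (k : ℝ) ≤ M := by exact_mod_cast h2
  have hx1 : (k : ℝ) / M ≤ 1 := by rw [div_le_one hM]; exact hk2
  have hx2 : 1 / (M : ℝ) ≤ k / M := by gcongr
  have hp := Real.pi_pos
  have := Real.mul_le_sin (x := Real.pi / 2 * (k / M)) (by positivity) (by nlinarith)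
  have e : 2 / Real.pi * (Real.pi / 2 * (k / M)) = (k : ℝ) / M := by field_simp
  rw [e] at this
  have h := pow_le_pow_left₀ (by positivity) (hx2.trans this) 2
  rwa [div_pow, one_pow] at h

lemma aux_chi (M k : ℕ) (hk : k ∈ Finset.Icc 1 M) :
    StrictAntiOn (chi (2 * M) M k) (Set.Ioo 0 1) ∧
    ∀ φ ∈ Set.Ioo (0 : ℝ) 1, chi (2 * M) M k φ ∈ Set.Ioo (0 : ℝ) 1 := by
  obtain ⟨h1, h2⟩ := Finset.mem_Icc.1 hk
  have hM : 1 ≤ M := by omega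
  have hσ := aux_sin M k hk
  have hM' : (0 : ℝ) < M := by exact_mod_cast (by omega : 0 < M)
  have hpsi := aux_psi M k hM
  set σ := Real.sin (Real.pi / 2 * (k / M)) ^ 2
  have hσ0 : 0 < σ := lt_of_lt_of_le (by positivity) hσ
  have hpos : ∀ φ ∈ Set.Ioo (0 : ℝ) 1, 0 < (1 - φ) ^ 2 / ((1 - φ) ^ 2 + 4 * φ * σ) := by
    intro φ hφ
    have := sub_pos.2 hφ.2
    have := hφ.1
    positivity
  by_cases he : Even k
  · have hE : Set.EqOn (fun φ : ℝ => (1 - φ) ^ 2 / ((1 - φ) ^ 2 + 4 * φ * σ))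
        (chi (2 * M) M k) (Set.Ioo 0 1) := by
      intro φ hφ
      simp only [chi, if_pos he]
      exact (hpsi φ hφ).symm
    refine ⟨(aux_even σ hσ0).congr hE, fun φ hφ => ?_⟩
    rw [← hE hφ]
    refine ⟨hpos φ hφ, aux_lt_one _ (aux_even σ hσ0) (by simp) ?_ φ hφ⟩
    apply ContinuousAt.div (by fun_prop) (by fun_prop)
    simp
  · have hE : Set.EqOn (fun φ : ℝ => (1 - φ) ^ 2 / ((1 - φ) ^ 2 + 4 * φ * σ) *
        ((1 + φ ^ M) / (1 - φ ^ M)))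
        (chi (2 * M) M k) (Set.Ioo 0 1) := by
      intro φ hφ
      simp only [chi, if_neg he, PsiBar]
      rw [hpsi φ hφ]
    have hz : (0 : ℝ) ^ M = 0 := zero_pow (by omega)
    refine ⟨(aux_odd M hM σ hσ).congr hE, fun φ hφ => ?_⟩
    rw [← hE hφ]
    refine ⟨?_, aux_lt_one _ (aux_odd M hM σ hσ) (by simp [hz]) ?_ φ hφ⟩
    · have p1 : φ ^ M < 1 := pow_lt_one₀ hφ.1.le hφ.2 (by omega)
      have p2 := pow_pos hφ.1 M
      exact mul_pos (hpos φ hφ) (div_pos (by linarith) (by linarith))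
    · apply ContinuousAt.mul
      · apply ContinuousAt.div (by fun_prop) (by fun_prop)
        simp
      · apply ContinuousAt.div (by fun_prop) (by fun_prop)
        simp [hz]

/-- Proposition 2, spectral form. Let `N = 2M`, `M ≥ 1`, `δ : (0,1) → ℝ`
differentiable, `c_1,…,c_M ≥ 0` not all zero, and
`ρ(φ) = Σ_{k=1}^{M} c_k δ(χ_k(φ))`. If `δ′ < 0` on `(0,1)` then `ρ` is strictly
increasing on `(0,1)`; if `δ′ > 0` on `(0,1)` then `ρ` is strictly decreasing. -/
theorem covariance_monotonicity (M N : ℕ) (hM : 1 ≤ M) (hN : N = 2 * M)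
    (δ : ℝ → ℝ) (hδ : ∀ χ ∈ Set.Ioo (0 : ℝ) 1, DifferentiableAt ℝ δ χ)
    (c : ℕ → ℝ) (hc : ∀ k ∈ Finset.Icc 1 M, 0 ≤ c k)
    (hc' : ∃ k ∈ Finset.Icc 1 M, 0 < c k) :
    ((∀ χ ∈ Set.Ioo (0 : ℝ) 1, deriv δ χ < 0) →
      StrictMonoOn (fun φ => ∑ k ∈ Finset.Icc 1 M, c k * δ (chi N M k φ))
        (Set.Ioo (0 : ℝ) 1)) ∧
    ((∀ χ ∈ Set.Ioo (0 : ℝ) 1, 0 < deriv δ χ) →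
      StrictAntiOn (fun φ => ∑ k ∈ Finset.Icc 1 M, c k * δ (chi N M k φ))
        (Set.Ioo (0 : ℝ) 1)) := by
  subst hN
  have hcont : ContinuousOn δ (Set.Ioo 0 1) :=
    fun x hx => (hδ x hx).continuousAt.continuousWithinAt
  constructor
  · intro hd
    have hanti : StrictAntiOn δ (Set.Ioo 0 1) :=
      strictAntiOn_of_deriv_neg (convex_Ioo 0 1) hcont (by rwa [interior_Ioo])
    intro a ha b hb hab
    have key : ∀ k ∈ Finset.Icc 1 M, δ (chi (2 * M) M k a) < δ (chi (2 * M) M k b) :=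
      fun k hk => hanti ((aux_chi M k hk).2 b hb) ((aux_chi M k hk).2 a ha)
        ((aux_chi M k hk).1 ha hb hab)
    obtain ⟨k, hk, hck⟩ := hc'
    exact Finset.sum_lt_sum
      (fun k hk => mul_le_mul_of_nonneg_left (key k hk).le (hc k hk))
      ⟨k, hk, mul_lt_mul_of_pos_left (key k hk) hck⟩
  · intro hd
    have hmono : StrictMonoOn δ (Set.Ioo 0 1) :=
      strictMonoOn_of_deriv_pos (convex_Ioo 0 1) hcont (by rwa [interior_Ioo])
    intro a ha b hb hab
    have key : ∀ k ∈ Finset.Icc 1 M, δ (chi (2 * M) M k b) < δ (chi (2 * M) M k a) :=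
      fun k hk => hmono ((aux_chi M k hk).2 b hb) ((aux_chi M k hk).2 a ha)
        ((aux_chi M k hk).1 ha hb hab)
    obtain ⟨k, hk, hck⟩ := hc'
    exact Finset.sum_lt_sum
      (fun k hk => mul_le_mul_of_nonneg_left (key k hk).le (hc k hk))
      ⟨k, hk, mul_lt_mul_of_pos_left (key k hk) hck⟩
end
end

section
/- (Positivity of the advantage–population covariance.) Under the setup of the comparative-statics eigenvalue result—D̄(φ) the row-normalized racetrack proximity matrix with eigenvalues χ_k(φ), V = q(D̄(φ))⁻¹p(D̄(φ)), A = s(D̄(φ))⁻¹r(D̄(φ)), C = I − (1/N)𝟙𝟙ᵀ, c > 0, and X = c((I−C) − CV)⁻¹CA—assume in addition that p(χ_k(φ))/q(χ_k(φ)) < 0 and r(χ_k(φ))/s(χ_k(φ)) > 0 for every k = 1,…,M. Then for every a ∈ ℝ^N, the quadratic form ρ := aᵀ (C X C) a satisfies ρ ≥ 0, with ρ = 0 if and only if Ca = 0 (i.e., a is a scalar multiple of the all-ones vector). In other words, if the uniform distribution is stable (G(χ_k) < 0 for all k) and the regional characteristic is advantageous (Gn(χ_k) > 0 for all k), then any non-uniform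 exogenous advantage is positively correlated with the induced population deviation. -/
open Real Matrix Finset Set Polynomial

noncomputable section

/-- Rational matrix function `q(D̄(φ))⁻¹ p(D̄(φ))` of the row-normalized
racetrack proximity matrix. -/
def ratMat (N M : ℕ) (φ : ℝ) (p q : Polynomial ℝ) : Matrix (Fin N) (Fin N) ℝ :=
  (Polynomial.aeval (Dbar N M φ) q)⁻¹ * Polynomial.aeval (Dbar N M φ) p

/-- Centering matrix `C = I − (1/N) 𝟙𝟙ᵀ`. -/
def Cmat (N : ℕ) : Matrix (Fin N) (Fin N) ℝ :=
  1 - ((N : ℝ)⁻¹) • Matrix.of (fun _ _ : Fin N => (1 : ℝ))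

/-- Comparative-statics matrix `X = c ((I−C) − C V)⁻¹ C A` with `V = G(D̄)` and
`A = Gn(D̄)`. -/
def Xmat (N M : ℕ) (φ : ℝ) (p q r s : Polynomial ℝ) (c : ℝ) :
    Matrix (Fin N) (Fin N) ℝ :=
  c • (((1 - Cmat N) - Cmat N * ratMat N M φ p q)⁻¹ * Cmat N * ratMat N M φ r s)

/-- Fourier projectors. -/
def Pk (N k : ℕ) : Matrix (Fin N) (Fin N) ℝ :=
  Matrix.of fun i j => (N : ℝ)⁻¹ * Real.cos (2 * Real.pi / N * k * ((i : ℕ) - (j : ℕ) : ℝ))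

theorem sum_cos_zero (N : ℕ) (α β : ℝ) (m : ℤ) (h : α * N = 2 * Real.pi * m)
    (hs : Real.sin (α / 2) ≠ 0) :
    ∑ j ∈ Finset.range N, Real.cos (α * j + β) = 0 := by
  have key : ∀ n : ℕ, 2 * Real.sin (α / 2) * ∑ j ∈ Finset.range n, Real.cos (α * j + β)
      = Real.sin (α * n - α / 2 + β) - Real.sin (- (α / 2) + β) := by
    intro n
    induction n with
    | zero => simp
    | succ n ih =>
      rw [Finset.sum_range_succ, mul_add, ih]
      have e1 : α * ((n + 1 : ℕ) : ℝ) - α / 2 + β = (α * n + β) + α / 2 := by push_cast; ring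
      have e2 : α * (n : ℝ) - α / 2 + β = (α * n + β) - α / 2 := by ring
      rw [e1, e2, Real.sin_add (α * n + β) (α / 2), Real.sin_sub (α * n + β) (α / 2)]
      ring
  have h2 := key N
  have e3 : α * N - α / 2 + β = (- (α / 2) + β) + m * (2 * Real.pi) := by rw [h]; ring
  rw [e3, Real.sin_add_int_mul_two_pi, sub_self] at h2
  rcases mul_eq_zero.1 h2 with h3 | h3
  · exact absurd (by linarith) hs
  · exact h3

theorem sin_ne (N : ℕ) (hN : 0 < N) (m : ℤ) (h0 : m ≠ 0) (h1 : m < N) (h2 : -(N : ℤ) < m) :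
    Real.sin (2 * Real.pi / N * m / 2) ≠ 0 := by
  intro h
  obtain ⟨n, hn⟩ := Real.sin_eq_zero_iff.1 h
  have hN' : (N : ℝ) ≠ 0 := by positivity
  have : (n : ℝ) * N = m := by
    have hp := Real.pi_ne_zero
    field_simp at hn
    linarith
  have h3 : n * (N : ℤ) = m := by exact_mod_cast this
  have h4 : (N : ℤ) ∣ m := ⟨n, by rw [← h3]; ring⟩
  exact h0 (Int.eq_zero_of_abs_lt_dvd h4 (abs_lt.2 ⟨h2, h1⟩))

theorem geo_cos (φ α β : ℝ) (n : ℕ) :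
    (∑ j ∈ Finset.range n, φ ^ j * Real.cos (α * j + β)) * (1 - 2 * φ * Real.cos α + φ ^ 2)
      = Real.cos β - φ * Real.cos (β - α) - φ ^ n * Real.cos (α * n + β)
        + φ ^ (n + 1) * Real.cos (α * n + β - α) := by
  induction n with
  | zero => simp
  | succ n ih =>
    rw [Finset.sum_range_succ, add_mul, ih]
    have e1 : α * ((n + 1 : ℕ) : ℝ) + β = (α * n + β) + α := by push_cast; ring
    have e2 : (α * n + β) + α - α = α * n + β := by ring
    rw [e1, e2, Real.cos_add (α * n + β) α, Real.cos_sub (α * n + β) α]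
    ring

theorem full_sum (M k : ℕ) (φ α β : ℝ) (h : α * M = k * Real.pi) :
    (∑ j ∈ Finset.range (2 * M), φ ^ (min j (2 * M - j)) * Real.cos (α * j + β))
      * (1 - 2 * φ * Real.cos α + φ ^ 2)
      = (1 - φ ^ 2) * (1 - (-1) ^ k * φ ^ M) * Real.cos β := by
  have hsplit : ∑ j ∈ Finset.range (2 * M), φ ^ (min j (2 * M - j)) * Real.cos (α * j + β)
      = (∑ j ∈ Finset.range M, φ ^ j * Real.cos (α * j + β))
        + φ * ∑ j ∈ Finset.range M, φ ^ j * Real.cos ((-α) * j + (β - α)) := by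
    rw [two_mul, Finset.sum_range_add]
    congr 1
    · apply Finset.sum_congr rfl
      intro j hj
      have := Finset.mem_range.1 hj
      rw [min_eq_left (by omega)]
    · rw [← Finset.sum_range_reflect, Finset.mul_sum]
      apply Finset.sum_congr rfl
      intro j hj
      have hj' := Finset.mem_range.1 hj
      have e1 : min (M + (M - 1 - j)) (M + M - (M + (M - 1 - j))) = j + 1 := by omega
      have e2 : ((M + (M - 1 - j) : ℕ) : ℝ) = 2 * M - 1 - j := by
        have : M + (M - 1 - j) + 1 + j = 2 * M := by omega
        have h2 : ((M + (M - 1 - j) + 1 + j : ℕ) : ℝ) = ((2 * M : ℕ) : ℝ) := by rw [this]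
        push_cast at h2 ⊢
        linarith
      have e3 : α * (2 * M - 1 - j) + β = ((-α) * j + (β - α)) + k * (2 * Real.pi) := by
        linear_combination 2 * h
      rw [e1, e2, e3, Real.cos_add_nat_mul_two_pi]
      ring
  have g1 := geo_cos φ α β M
  have g2 := geo_cos φ (-α) (β - α) M
  rw [Real.cos_neg] at g2
  have c1 : Real.cos (α * M + β) = (-1) ^ k * Real.cos β := by
    rw [h, add_comm, Real.cos_add_nat_mul_pi]
  have c2 : Real.cos (α * M + β - α) = (-1) ^ k * Real.cos (β - α) := by
    rw [h, ← Real.cos_add_nat_mul_pi]; congr 1; ring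
  have c3 : Real.cos (-α * M + (β - α)) = (-1) ^ k * Real.cos (β - α) := by
    rw [← Real.cos_sub_nat_mul_pi]; congr 1; linear_combination -h
  have c4 : Real.cos (-α * M + (β - α) - -α) = (-1) ^ k * Real.cos β := by
    rw [← Real.cos_sub_nat_mul_pi]; congr 1; linear_combination -h
  have c5 : β - α - -α = β := by ring
  rw [c1, c2] at g1
  rw [c3, c4, c5] at g2
  rw [hsplit, add_mul, g1, mul_assoc, g2]
  ring

theorem Dmat_Pk (N M : ℕ) (hM : 1 ≤ M) (hN : N = 2 * M) (φ : ℝ) (k : ℕ) :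
    (1 - 2 * φ * Real.cos (2 * Real.pi / N * k) + φ ^ 2) • (Dmat N φ * Pk N k)
      = ((1 - φ ^ 2) * (1 - (-1) ^ k * φ ^ M)) • Pk N k := by
  have : NeZero N := ⟨by omega⟩
  have hN0 : (N : ℝ) ≠ 0 := NeZero.ne _
  ext i l
  set α := 2 * Real.pi / N * k with hα
  have hαN : α * N = k * (2 * Real.pi) := by rw [hα]; field_simp
  have hαM : α * M = k * Real.pi := by
    have : (N : ℝ) = 2 * M := by rw [hN]; push_cast; ring
    rw [this] at hαN; linarith
  have hsum : (Dmat N φ * Pk N k) i l = (N : ℝ)⁻¹ * ∑ j ∈ Finset.range (2 * M),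
      φ ^ (min j (2 * M - j)) * Real.cos (α * j + α * ((i : ℕ) - (l : ℕ))) := by
    rw [Matrix.mul_apply, ← hN, ← Fin.sum_univ_eq_sum_range
      (fun j => φ ^ (min j (N - j)) * Real.cos (α * j + α * ((i : ℕ) - (l : ℕ)))), Finset.mul_sum,
      ← Equiv.sum_comp (Equiv.addLeft i)]
    apply Finset.sum_congr rfl
    intro j _
    have hi := i.2
    have hj := j.2
    simp only [Dmat, Pk, Matrix.of_apply, Equiv.coe_addLeft, rdist, Fin.val_add]
    rw [← hα]
    rcases lt_or_ge ((i : ℕ) + j) N with hlt | hge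
    · rw [Nat.mod_eq_of_lt hlt]
      have e1 : min (max ((i : ℕ) - (i + j : ℕ)) ((i + j : ℕ) - (i : ℕ)))
        (N - max ((i : ℕ) - (i + j : ℕ)) ((i + j : ℕ) - (i : ℕ))) = min (j : ℕ) (N - j) := by omega
      have e2 : α * (((i + j : ℕ) : ℝ) - (l : ℕ)) = α * j + α * ((i : ℕ) - (l : ℕ)) := by
        push_cast; ring
      rw [e1, e2]; ring
    · have hm : ((i : ℕ) + j) % N = i + j - N := by
        rw [Nat.mod_eq_sub_mod hge, Nat.mod_eq_of_lt (by omega)]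
      rw [hm]
      have e1 : min (max ((i : ℕ) - (i + j - N : ℕ)) ((i + j - N : ℕ) - (i : ℕ)))
        (N - max ((i : ℕ) - (i + j - N : ℕ)) ((i + j - N : ℕ) - (i : ℕ)))
          = min (j : ℕ) (N - j) := by omega
      have e2 : α * j + α * ((i : ℕ) - (l : ℕ))
          = α * (((i + j - N : ℕ) : ℝ) - (l : ℕ)) + k * (2 * Real.pi) := by
        rw [Nat.cast_sub hge]; push_cast; linear_combination hαN
      rw [e1, e2, Real.cos_add_nat_mul_two_pi]; ring
  have hf := full_sum M k φ α (α * ((i : ℕ) - (l : ℕ))) hαM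
  rw [Matrix.smul_apply, Matrix.smul_apply, hsum]
  simp only [Pk, Matrix.of_apply, smul_eq_mul]
  rw [← hα]
  linear_combination (N : ℝ)⁻¹ * hf

theorem Q_pos (φ x : ℝ) (hφ : φ ∈ Set.Ioo (0 : ℝ) 1) : 0 < 1 - 2 * φ * Real.cos x + φ ^ 2 := by
  obtain ⟨h0, h1⟩ := hφ
  nlinarith [Real.cos_le_one x, mul_nonneg h0.le (sub_nonneg.2 (Real.cos_le_one x)),
    pow_pos (sub_pos.2 h1) 2]

theorem Dbar_Pk (N M : ℕ) (hM : 1 ≤ M) (hN : N = 2 * M) (φ : ℝ)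
    (hφ : φ ∈ Set.Ioo (0 : ℝ) 1) (k : ℕ) :
    Dbar N M φ * Pk N k = chi N M k φ • Pk N k := by
  have hQ := Q_pos φ (2 * Real.pi / N * k) hφ
  have hD := Dmat_Pk N M hM hN φ k
  have hM0 : (M : ℝ) ≠ 0 := by positivity
  have hcos : Real.cos (2 * Real.pi / N * M) = -1 := by
    have : 2 * Real.pi / N * M = Real.pi := by rw [hN]; push_cast; field_simp
    rw [this, Real.cos_pi]
  obtain ⟨h0, h1⟩ := hφ
  have hpM : φ ^ M < 1 := pow_lt_one₀ h0.le h1 (by omega)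
  have a1 : 1 - φ ≠ 0 := by linarith
  have a2 : 1 - φ ^ M ≠ 0 := by linarith
  have a3 : 1 + φ ≠ 0 := by linarith
  have hD' : Dmat N φ * Pk N k = ((1 - 2 * φ * Real.cos (2 * Real.pi / N * k) + φ ^ 2)⁻¹ *
      ((1 - φ ^ 2) * (1 - (-1) ^ k * φ ^ M))) • Pk N k := by
    rw [mul_smul, ← hD, smul_smul, inv_mul_cancel₀ hQ.ne', one_smul]
  rw [Dbar, Matrix.smul_mul, hD', smul_smul]
  congr 1
  unfold chi Psi PsiBar Srow
  rw [hcos]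
  have a4 : 1 - 2 * φ * (-1) + φ ^ 2 = (1 + φ) ^ 2 := by ring
  rw [a4]
  have hQ' := hQ.ne'
  generalize (1 - 2 * φ * Real.cos (2 * Real.pi / N * k) + φ ^ 2) = Q at hQ'
  split_ifs with hk
  · rw [hk.neg_one_pow]
    field_simp
    ring
  · rw [(Nat.not_even_iff_odd.1 hk).neg_one_pow]
    field_simp
    ring

theorem chi_symm (N M : ℕ) (hM : 1 ≤ M) (hN : N = 2 * M) (φ : ℝ) (k : ℕ) (hk : k ≤ N) :
    chi N M (N - k) φ = chi N M k φ := by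
  have hN0 : (N : ℝ) ≠ 0 := by
    have : N ≠ 0 := by omega
    exact_mod_cast this
  have h1 : Psi N (N - k) φ = Psi N k φ := by
    unfold Psi
    have : 2 * Real.pi / N * ((N - k : ℕ) : ℝ) = 2 * Real.pi - 2 * Real.pi / N * k := by
      rw [Nat.cast_sub hk]; field_simp
    rw [this, Real.cos_two_pi_sub]
  have h2 : Even (N - k) ↔ Even k := by
    rw [Nat.even_sub hk]
    simp [hN]
  unfold chi
  simp only [h1, h2]

theorem Pk_ne (N : ℕ) (hN : 0 < N) (k : ℕ) : Pk N k ≠ 0 := by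
  intro h
  have := congrFun (congrFun h ⟨0, hN⟩) ⟨0, hN⟩
  simp [Pk] at this
  omega

theorem Pk_zero (N : ℕ) : Pk N 0 = 1 - Cmat N := by
  ext i j
  simp [Pk, Cmat]

theorem Cmat_eq (N : ℕ) (hN : 0 < N) : Cmat N = ∑ k ∈ Finset.Ico 1 N, Pk N k := by
  have h1 : ∑ k ∈ Finset.range N, Pk N k = 1 := by
    have hN0 : (N : ℝ) ≠ 0 := by positivity
    ext i j
    rw [Matrix.sum_apply]
    simp only [Pk, Matrix.of_apply]
    rw [← Finset.mul_sum]
    by_cases hij : i = j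
    · subst hij
      simp [hN0]
    · have hij' : (i : ℕ) ≠ j := fun h => hij (Fin.ext h)
      have hi := i.2
      have hj := j.2
      have hz := sum_cos_zero N (2 * Real.pi / N * (((i : ℕ) : ℤ) - ((j : ℕ) : ℤ) : ℤ)) 0
        (((i : ℕ) : ℤ) - ((j : ℕ) : ℤ)) (by field_simp)
        (sin_ne N hN _ (by omega) (by omega) (by omega))
      rw [Matrix.one_apply_ne hij]
      rw [mul_eq_zero]
      right
      rw [← hz]
      apply Finset.sum_congr rfl
      intro k _
      congr 1
      push_cast
      ring
  rw [Finset.range_eq_Ico, Finset.sum_eq_sum_Ico_succ_bot hN, Pk_zero] at h1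
  have h2 : Cmat N = 1 - (1 - Cmat N) := by abel
  rw [h2]
  nth_rewrite 1 [← h1]
  simp

theorem ones_Pk (N : ℕ) (k : ℕ) (hk : k ∈ Finset.Ico 1 N) :
    Cmat N * Pk N k = Pk N k := by
  have hk' := Finset.mem_Ico.1 hk
  have hN : 0 < N := by omega
  have hN0 : (N : ℝ) ≠ 0 := by positivity
  rw [Cmat, Matrix.sub_mul, one_mul, sub_eq_self, Matrix.smul_mul]
  ext i l
  simp only [Matrix.smul_apply, Matrix.mul_apply, Matrix.of_apply, Pk, one_mul, smul_eq_mul,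
    Matrix.zero_apply]
  rw [← Finset.mul_sum, mul_eq_zero]
  right
  rw [mul_eq_zero]
  right
  rw [Fin.sum_univ_eq_sum_range
    (fun j => Real.cos (2 * Real.pi / N * k * ((j : ℝ) - (l : ℕ)))) N]
  have hz := sum_cos_zero N (2 * Real.pi / N * ((k : ℤ) : ℝ)) (-(2 * Real.pi / N * k * (l : ℕ)))
        (k : ℤ) (by field_simp)
        (sin_ne N hN _ (by omega) (by omega) (by omega))
  rw [← hz]
  apply Finset.sum_congr rfl
  intro j _
  congr 1
  push_cast
  ring

theorem C_P0 (N : ℕ) (hN : 0 < N) : Cmat N * Pk N 0 = 0 := by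
  have h : Cmat N * Cmat N = Cmat N := by
    nth_rewrite 2 [Cmat_eq N hN]
    rw [Finset.mul_sum, Finset.sum_congr rfl (fun k hk => ones_Pk N k hk), ← Cmat_eq N hN]
  rw [Pk_zero, mul_sub, mul_one, h, sub_self]

theorem aeval_mul_eig {n : ℕ} (B P : Matrix (Fin n) (Fin n) ℝ) (x : ℝ) (h : B * P = x • P)
    (f : Polynomial ℝ) : Polynomial.aeval B f * P = f.eval x • P := by
  induction f using Polynomial.induction_on' with
  | add f g hf hg => rw [map_add, add_mul, hf, hg, Polynomial.eval_add, add_smul]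
  | monomial m a =>
    have hpow : ∀ m : ℕ, B ^ m * P = x ^ m • P := by
      intro m
      induction m with
      | zero => simp
      | succ m ih => rw [pow_succ, mul_assoc, h, Matrix.mul_smul, ih, smul_smul, pow_succ, mul_comm]
    rw [Polynomial.aeval_monomial, mul_assoc, hpow, Polynomial.eval_monomial,
      Matrix.mul_smul, Algebra.algebraMap_eq_smul_one, Matrix.smul_mul, one_mul, smul_smul, mul_comm]

theorem inv_mul_eig {n : ℕ} (Q P : Matrix (Fin n) (Fin n) ℝ) (y : ℝ) (hQ : IsUnit Q)
    (hP : P ≠ 0) (h : Q * P = y • P) : Q⁻¹ * P = y⁻¹ • P := by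
  have hd := (Matrix.isUnit_iff_isUnit_det Q).1 hQ
  have h1 : P = y • (Q⁻¹ * P) := by
    rw [← Matrix.mul_smul, ← h, ← mul_assoc, Matrix.nonsing_inv_mul _ hd, one_mul]
  have hy : y ≠ 0 := by
    rintro rfl
    rw [zero_smul] at h1
    exact hP h1
  nth_rewrite 2 [h1]
  rw [smul_smul, inv_mul_cancel₀ hy, one_smul]

theorem ratMat_Pk (N M : ℕ) (hM : 1 ≤ M) (hN : N = 2 * M) (φ : ℝ)
    (hφ : φ ∈ Set.Ioo (0 : ℝ) 1) (k : ℕ) (p q : Polynomial ℝ)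
    (hq : IsUnit (Polynomial.aeval (Dbar N M φ) q)) :
    ratMat N M φ p q * Pk N k
      = (p.eval (chi N M k φ) / q.eval (chi N M k φ)) • Pk N k := by
  have hB := Dbar_Pk N M hM hN φ hφ k
  rw [ratMat, mul_assoc, aeval_mul_eig _ _ _ hB, Matrix.mul_smul,
    inv_mul_eig _ _ _ hq (Pk_ne N (by omega) k) (aeval_mul_eig _ _ _ hB q), smul_smul]
  rfl

theorem Pk_psd (N k : ℕ) (a : Fin N → ℝ) : 0 ≤ a ⬝ᵥ (Pk N k).mulVec a := by
  set α := 2 * Real.pi / N * k with hα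
  have : a ⬝ᵥ (Pk N k).mulVec a = (N : ℝ)⁻¹ * ((∑ i, a i * Real.cos (α * (i : ℕ))) ^ 2
      + (∑ i, a i * Real.sin (α * (i : ℕ))) ^ 2) := by
    simp only [dotProduct, Matrix.mulVec, Pk, Matrix.of_apply]
    rw [pow_two, pow_two, Finset.sum_mul_sum, Finset.sum_mul_sum, ← Finset.sum_add_distrib,
      Finset.mul_sum]
    apply Finset.sum_congr rfl
    intro i _
    rw [← Finset.sum_add_distrib, Finset.mul_sum, Finset.mul_sum]
    apply Finset.sum_congr rfl
    intro j _
    rw [← hα, mul_sub, Real.cos_sub]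
    ring
  rw [this]
  positivity

theorem CXC_eq (N M : ℕ) (hM : 1 ≤ M) (hN : N = 2 * M)
    (φ : ℝ) (hφ : φ ∈ Set.Ioo (0 : ℝ) 1)
    (p q r s : Polynomial ℝ)
    (hq : IsUnit (Polynomial.aeval (Dbar N M φ) q))
    (hs : IsUnit (Polynomial.aeval (Dbar N M φ) s)) (c : ℝ)
    (hV : ∀ k ∈ Finset.Ico 1 N, p.eval (chi N M k φ) / q.eval (chi N M k φ) ≠ 0) :
    Cmat N * Xmat N M φ p q r s c * Cmat N = ∑ k ∈ Finset.Ico 1 N,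
      (c * ((r.eval (chi N M k φ) / s.eval (chi N M k φ)) *
        (-(p.eval (chi N M k φ) / q.eval (chi N M k φ)))⁻¹)) • Pk N k := by
  have hN0 : 0 < N := by omega
  set W := (1 - Cmat N) - Cmat N * ratMat N M φ p q with hW
  have hWP : ∀ k ∈ Finset.Ico 1 N, W * Pk N k
      = (-(p.eval (chi N M k φ) / q.eval (chi N M k φ))) • Pk N k := by
    intro k hk
    rw [hW, sub_mul, sub_mul, one_mul, ones_Pk N k hk, sub_self, mul_assoc,
      ratMat_Pk N M hM hN φ hφ k p q hq, Matrix.mul_smul, ones_Pk N k hk, zero_sub, neg_smul]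
  have hW0 : W * Pk N 0 = Pk N 0 := by
    rw [hW, sub_mul, sub_mul, one_mul, C_P0 N hN0, sub_zero, mul_assoc,
      ratMat_Pk N M hM hN φ hφ 0 p q hq, Matrix.mul_smul, C_P0 N hN0, smul_zero, sub_zero]
  have hWu : IsUnit W := by
    have hY : W * (Pk N 0 + ∑ k ∈ Finset.Ico 1 N,
        (-(p.eval (chi N M k φ) / q.eval (chi N M k φ)))⁻¹ • Pk N k) = 1 := by
      rw [mul_add, hW0, Finset.mul_sum]
      have : ∀ k ∈ Finset.Ico 1 N,
          W * ((-(p.eval (chi N M k φ) / q.eval (chi N M k φ)))⁻¹ • Pk N k) = Pk N k := by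
        intro k hk
        rw [Matrix.mul_smul, hWP k hk, smul_smul, inv_mul_cancel₀ (neg_ne_zero.2 (hV k hk)),
          one_smul]
      rw [Finset.sum_congr rfl this, ← Cmat_eq N hN0, Pk_zero]
      abel
    exact (Matrix.isUnit_iff_isUnit_det W).2 (Matrix.isUnit_det_of_right_inverse hY)
  nth_rewrite 2 [Cmat_eq N hN0]
  rw [Finset.mul_sum]
  apply Finset.sum_congr rfl
  intro k hk
  rw [Xmat, ← hW, Matrix.mul_smul, Matrix.smul_mul, mul_assoc, mul_assoc (W⁻¹ * Cmat N),
    ratMat_Pk N M hM hN φ hφ k r s hs, Matrix.mul_smul, mul_assoc, ones_Pk N k hk,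
    inv_mul_eig W _ _ hWu (Pk_ne N hN0 k) (hWP k hk), Matrix.mul_smul, Matrix.mul_smul,
    ones_Pk N k hk, smul_smul, smul_smul, mul_assoc]

/-- Positivity of the advantage–population covariance. Under the comparative-statics
setup, if additionally `G(χ_k(φ)) = p(χ_k)/q(χ_k) < 0` (stability) and
`Gn(χ_k(φ)) = r(χ_k)/s(χ_k) > 0` (advantageous characteristic) for all
`k = 1,…,M`, then for every `a ∈ ℝ^N` the covariance `ρ = aᵀ (C X C) a` is
nonnegative, and `ρ = 0` iff `C a = 0`, i.e. `a` is uniform. -/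
theorem covariance_positivity (N M : ℕ) (hM : 1 ≤ M) (hN : N = 2 * M)
    (φ : ℝ) (hφ : φ ∈ Set.Ioo (0 : ℝ) 1)
    (p q r s : Polynomial ℝ)
    (hq : IsUnit (Polynomial.aeval (Dbar N M φ) q))
    (hs : IsUnit (Polynomial.aeval (Dbar N M φ) s))
    (hp : ∀ k, 1 ≤ k → k ≤ M → p.eval (chi N M k φ) ≠ 0)
    (c : ℝ) (hc : 0 < c)
    (hstab : ∀ k, 1 ≤ k → k ≤ M →
      p.eval (chi N M k φ) / q.eval (chi N M k φ) < 0)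
    (hadv : ∀ k, 1 ≤ k → k ≤ M →
      0 < r.eval (chi N M k φ) / s.eval (chi N M k φ)) :
    ∀ a : Fin N → ℝ,
      0 ≤ a ⬝ᵥ (Cmat N * Xmat N M φ p q r s c * Cmat N).mulVec a ∧
      (a ⬝ᵥ (Cmat N * Xmat N M φ p q r s c * Cmat N).mulVec a = 0 ↔
        (Cmat N).mulVec a = 0) := by
  have hN0 : 0 < N := by omega
  have hk : ∀ k ∈ Finset.Ico 1 N, ∃ k', 1 ≤ k' ∧ k' ≤ M ∧ chi N M k' φ = chi N M k φ := by
    intro k hk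
    have hk' := Finset.mem_Ico.1 hk
    rcases le_or_gt k M with h | h
    · exact ⟨k, hk'.1, h, rfl⟩
    · exact ⟨N - k, by omega, by omega, chi_symm N M hM hN φ k (by omega)⟩
  have hV : ∀ k ∈ Finset.Ico 1 N, p.eval (chi N M k φ) / q.eval (chi N M k φ) < 0 := by
    intro k h
    obtain ⟨k', h1, h2, h3⟩ := hk k h
    rw [← h3]; exact hstab k' h1 h2
  have hA : ∀ k ∈ Finset.Ico 1 N, 0 < r.eval (chi N M k φ) / s.eval (chi N M k φ) := by
    intro k h
    obtain ⟨k', h1, h2, h3⟩ := hk k h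
    rw [← h3]; exact hadv k' h1 h2
  intro a
  have hterm : ∀ k ∈ Finset.Ico 1 N, 0 < c * ((r.eval (chi N M k φ) / s.eval (chi N M k φ)) *
        (-(p.eval (chi N M k φ) / q.eval (chi N M k φ)))⁻¹) := by
    intro k h
    exact mul_pos hc (mul_pos (hA k h) (inv_pos.2 (neg_pos.2 (hV k h))))
  have hform : a ⬝ᵥ (Cmat N * Xmat N M φ p q r s c * Cmat N).mulVec a
      = ∑ k ∈ Finset.Ico 1 N, (c * ((r.eval (chi N M k φ) / s.eval (chi N M k φ)) *
        (-(p.eval (chi N M k φ) / q.eval (chi N M k φ)))⁻¹)) * (a ⬝ᵥ (Pk N k).mulVec a) := by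
    rw [CXC_eq N M hM hN φ hφ p q r s hq hs c (fun k h => (hV k h).ne), Matrix.sum_mulVec,
      dotProduct_sum]
    apply Finset.sum_congr rfl
    intro k _
    rw [Matrix.smul_mulVec, dotProduct_smul, smul_eq_mul]
  have hnn : ∀ k ∈ Finset.Ico 1 N, 0 ≤ (c * ((r.eval (chi N M k φ) / s.eval (chi N M k φ)) *
        (-(p.eval (chi N M k φ) / q.eval (chi N M k φ)))⁻¹)) * (a ⬝ᵥ (Pk N k).mulVec a) :=
    fun k h => mul_nonneg (hterm k h).le (Pk_psd N k a)
  refine ⟨?_, ?_, ?_⟩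
  · rw [hform]
    exact Finset.sum_nonneg hnn
  · intro h
    rw [hform, Finset.sum_eq_zero_iff_of_nonneg hnn] at h
    have hz : a ⬝ᵥ (Cmat N).mulVec a = 0 := by
      rw [Cmat_eq N hN0, Matrix.sum_mulVec, dotProduct_sum]
      apply Finset.sum_eq_zero
      intro k hk
      exact (mul_eq_zero.1 (h k hk)).resolve_left (hterm k hk).ne'
    have hCC : Cmat N * Cmat N = Cmat N := by
      have := C_P0 N hN0
      rw [Pk_zero, mul_sub, mul_one, sub_eq_zero] at this
      exact this.symm
    have hCT : (Cmat N)ᵀ = Cmat N := by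
      ext i j
      simp [Cmat, Matrix.one_apply, eq_comm]
    rw [← dotProduct_self_eq_zero]
    rw [Matrix.dotProduct_mulVec, ← Matrix.mulVec_transpose, hCT, Matrix.mulVec_mulVec, hCC,
      dotProduct_comm]
    exact hz
  · intro h
    rw [← Matrix.mulVec_mulVec, h, Matrix.mulVec_zero, dotProduct_zero]
end
end

section
/- (Class membership of the Krugman model.) Fix μ ∈ (0,1) and σ > 1 and define the quadratic G♯(χ) = μ(1/(σ−1) + 1/σ)χ − (μ²/(σ−1) + 1/σ)χ². If (1−μ)σ > 1, then G♯ has a unique zero χ* in (0,1), given by χ* = μ(1/(σ−1)+1/σ)/(μ²/(σ−1)+1/σ), with G♯(χ) > 0 for all χ ∈ (0,χ*) and G♯(χ) < 0 for all χ ∈ (χ*,1) (so the model is of Class I). If (1−μ)σ ≤ 1, then G♯(χ) > 0 for all χ ∈ (0,1). -/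
open Real Set

noncomputable section

/-- Net gain function of the Krugman (1991) model:
`G♯(χ) = μ(1/(σ−1)+1/σ)χ − (μ²/(σ−1)+1/σ)χ²`. -/
def GsKrugman (μ σ χ : ℝ) : ℝ :=
  μ * (1 / (σ - 1) + 1 / σ) * χ - (μ ^ 2 / (σ - 1) + 1 / σ) * χ ^ 2

/-- Class membership of the Krugman model. Fix `μ ∈ (0,1)` and `σ > 1`. If
`(1−μ)σ > 1`, then `G♯` has a unique zero `χ* ∈ (0,1)`, given by
`χ* = μ(1/(σ−1)+1/σ)/(μ²/(σ−1)+1/σ)`, with `G♯ > 0` on `(0,χ*)` and `G♯ < 0`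
on `(χ*,1)` (Class I). If `(1−μ)σ ≤ 1`, then `G♯ > 0` on all of `(0,1)`. -/
theorem krugman_classI (μ σ : ℝ) (hμ : μ ∈ Set.Ioo (0 : ℝ) 1) (hσ : 1 < σ) :
    ((1 - μ) * σ > 1 →
      (μ * (1 / (σ - 1) + 1 / σ) / (μ ^ 2 / (σ - 1) + 1 / σ)) ∈ Set.Ioo (0 : ℝ) 1 ∧
      GsKrugman μ σ (μ * (1 / (σ - 1) + 1 / σ) / (μ ^ 2 / (σ - 1) + 1 / σ)) = 0 ∧
      (∀ χ ∈ Set.Ioo (0 : ℝ)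
          (μ * (1 / (σ - 1) + 1 / σ) / (μ ^ 2 / (σ - 1) + 1 / σ)),
        0 < GsKrugman μ σ χ) ∧
      (∀ χ ∈ Set.Ioo
          (μ * (1 / (σ - 1) + 1 / σ) / (μ ^ 2 / (σ - 1) + 1 / σ)) (1 : ℝ),
        GsKrugman μ σ χ < 0) ∧
      (∀ χ ∈ Set.Ioo (0 : ℝ) 1, GsKrugman μ σ χ = 0 →
        χ = μ * (1 / (σ - 1) + 1 / σ) / (μ ^ 2 / (σ - 1) + 1 / σ))) ∧
    ((1 - μ) * σ ≤ 1 → ∀ χ ∈ Set.Ioo (0 : ℝ) 1, 0 < GsKrugman μ σ χ) := by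
  obtain ⟨h0, h1⟩ := hμ
  have hs : 0 < σ := by linarith
  have hs1 : 0 < σ - 1 := by linarith
  have hba : (μ ^ 2 / (σ - 1) + 1 / σ) - μ * (1 / (σ - 1) + 1 / σ)
      = (1 - μ) * ((1 - μ) * σ - 1) / (σ * (σ - 1)) := by
    field_simp
    ring
  have ha : 0 < μ * (1 / (σ - 1) + 1 / σ) := by positivity
  have hb : 0 < μ ^ 2 / (σ - 1) + 1 / σ := by positivity
  unfold GsKrugman
  generalize μ * (1 / (σ - 1) + 1 / σ) = a at *
  generalize μ ^ 2 / (σ - 1) + 1 / σ = b at *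
  have hG : ∀ x : ℝ, a * x - b * x ^ 2 = x * (a - x * b) := fun x => by ring
  simp only [hG]
  have hd : a / b * b = a := div_mul_cancel₀ a hb.ne'
  constructor
  · intro h
    have hab : 0 < b - a := by
      rw [hba]
      exact div_pos (mul_pos (by linarith) (by linarith)) (mul_pos hs hs1)
    have hq : 0 < a / b := div_pos ha hb
    refine ⟨⟨hq, (div_lt_one hb).2 (by linarith)⟩, ?_, ?_, ?_, ?_⟩
    · rw [hd, sub_self, mul_zero]
    · rintro x ⟨hx0, hx⟩
      have := (lt_div_iff₀ hb).1 hx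
      exact mul_pos hx0 (by linarith)
    · rintro x ⟨hx, _⟩
      have := (div_lt_iff₀ hb).1 hx
      exact mul_neg_of_pos_of_neg (hq.trans hx) (by linarith)
    · rintro x ⟨hx0, _⟩ hz
      rcases mul_eq_zero.1 hz with hz | hz
      · exact absurd hz hx0.ne'
      · exact (eq_div_iff hb.ne').2 (by linarith)
  · rintro h x ⟨hx0, hx1⟩
    have hab : b - a ≤ 0 := by
      rw [hba]
      exact div_nonpos_of_nonpos_of_nonneg
        (mul_nonpos_of_nonneg_of_nonpos (by linarith) (by linarith)) (mul_pos hs hs1).le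
    have : x * b < 1 * b := mul_lt_mul_of_pos_right hx1 hb
    exact mul_pos hx0 (by linarith)
end
end

section
/- (Class membership of the Helpman model.) Fix μ ∈ (0,1) and σ > 1 and define the quadratic G♯(χ) = −(1−μ) + μ(1/(σ−1) + 1/σ)χ − (μ²/(σ−1) + 1/σ − (1−μ))χ². If (1−μ)σ < 1, then G♯ has a unique zero χ** in (0,1), with G♯(χ) < 0 for all χ ∈ (0,χ**) and G♯(χ) > 0 for all χ ∈ (χ**,1) (so the model is of Class II). If (1−μ)σ ≥ 1, then G♯(χ) < 0 for all χ ∈ (0,1). -/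
open Real Set

noncomputable section

/-- Net gain function of the Helpman (1998) model:
`G♯(χ) = −(1−μ) + μ(1/(σ−1)+1/σ)χ − (μ²/(σ−1)+1/σ−(1−μ))χ²`. -/
def GsHelpman (μ σ χ : ℝ) : ℝ :=
  -(1 - μ) + μ * (1 / (σ - 1) + 1 / σ) * χ -
    (μ ^ 2 / (σ - 1) + 1 / σ - (1 - μ)) * χ ^ 2

/-- Class membership of the Helpman model. Fix `μ ∈ (0,1)` and `σ > 1`. If
`(1−μ)σ < 1`, then `G♯` has a unique zero `χ** ∈ (0,1)`, with `G♯ < 0` on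
`(0,χ**)` and `G♯ > 0` on `(χ**,1)` (Class II). If `(1−μ)σ ≥ 1`, then `G♯ < 0`
on all of `(0,1)`. -/
theorem helpman_classII (μ σ : ℝ) (hμ : μ ∈ Set.Ioo (0 : ℝ) 1) (hσ : 1 < σ) :
    ((1 - μ) * σ < 1 →
      ∃ χss ∈ Set.Ioo (0 : ℝ) 1,
        GsHelpman μ σ χss = 0 ∧
        (∀ χ ∈ Set.Ioo (0 : ℝ) χss, GsHelpman μ σ χ < 0) ∧
        (∀ χ ∈ Set.Ioo χss (1 : ℝ), 0 < GsHelpman μ σ χ) ∧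
        (∀ χ ∈ Set.Ioo (0 : ℝ) 1, GsHelpman μ σ χ = 0 → χ = χss)) ∧
    (1 ≤ (1 - μ) * σ → ∀ χ ∈ Set.Ioo (0 : ℝ) 1, GsHelpman μ σ χ < 0) := by
  obtain ⟨h0, h1⟩ := hμ
  have hs1 : 0 < σ - 1 := by linarith
  have hs0 : 0 < σ := by linarith
  constructor
  · intro h
    have hG1 : 0 < GsHelpman μ σ 1 := by
      have e : GsHelpman μ σ 1 = (1 - μ) * (1 - (1 - μ) * σ) / (σ * (σ - 1)) := by
        unfold GsHelpman
        field_simp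
        ring
      rw [e]
      have := sub_pos.2 h
      have := sub_pos.2 h1
      positivity
    have hG0 : GsHelpman μ σ 0 < 0 := by
      unfold GsHelpman
      linarith
    have hc : ContinuousOn (GsHelpman μ σ) (Set.Icc 0 1) := by
      apply Continuous.continuousOn
      unfold GsHelpman
      fun_prop
    obtain ⟨r, ⟨hr0, hr1⟩, hr⟩ := intermediate_value_Ioo (zero_le_one) hc ⟨hG0, hG1⟩
    obtain ⟨b, c, hbc⟩ : ∃ b c : ℝ, ∀ x, GsHelpman μ σ x = (x - r) * (b - c * (x + r)) := by
      refine ⟨μ * (1 / (σ - 1) + 1 / σ), μ ^ 2 / (σ - 1) + 1 / σ - (1 - μ), fun x => ?_⟩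
      have : GsHelpman μ σ x = GsHelpman μ σ x - GsHelpman μ σ r := by rw [hr, sub_zero]
      rw [this]
      unfold GsHelpman
      ring
    rw [hbc] at hG0 hG1
    have k0 : 0 < b - c * r := by
      by_contra hh
      nlinarith
    have k1 : 0 < b - c * (1 + r) := by
      by_contra hh
      nlinarith
    have key : ∀ x, 0 < x → x < 1 → 0 < b - c * (x + r) := by
      intro x hx0 hx1
      nlinarith [mul_pos hx0 k1, mul_pos (sub_pos.2 hx1) k0]
    refine ⟨r, ⟨hr0, hr1⟩, hr, ?_, ?_, ?_⟩
    · rintro x ⟨hx0, hx1⟩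
      rw [hbc]
      exact mul_neg_of_neg_of_pos (by linarith) (key x hx0 (by linarith))
    · rintro x ⟨hx0, hx1⟩
      rw [hbc]
      exact mul_pos (by linarith) (key x (by linarith) hx1)
    · rintro x ⟨hx0, hx1⟩ hx
      rw [hbc] at hx
      rcases mul_eq_zero.1 hx with hx | hx
      · linarith
      · exact absurd hx (key x hx0 hx1).ne'
  · rintro h x ⟨hx0, hx1⟩
    have hm : 0 < 1 - μ * x := by nlinarith
    have e : GsHelpman μ σ x = (-(1 - μ) * (1 - x ^ 2) * σ * (σ - 1)
        + μ * x * (1 - μ * x) * σ + x * (μ - x) * (σ - 1)) / (σ * (σ - 1)) := by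
      unfold GsHelpman
      field_simp
      ring
    rw [e]
    apply div_neg_of_neg_of_pos _ (mul_pos hs0 hs1)
    have a1 : 0 ≤ ((1 - μ) * σ - 1) * (x * (1 - μ * x)) :=
      mul_nonneg (by linarith) (mul_pos hx0 hm).le
    have a2 : 0 ≤ ((1 - μ) * σ - 1) * ((1 - x ^ 2) * (σ - 1)) :=
      mul_nonneg (by linarith) (mul_nonneg (by nlinarith) hs1.le)
    have a3 : 0 < (σ - 1) * ((1 - x) * (1 - μ * x)) :=
      mul_pos hs1 (mul_pos (by linarith) hm)
    -- (1-μ)(σ-1) - μ = (1-μ)σ - 1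
    nlinarith
end
end
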